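/- arXiv:1205.6387 — 6 statements merged into one kernel-verified Lean document; each statement's English description precedes it below -/
import Mathlib

section
/- Suppose the columns of z generate ℤ^r (effective action) and the orbit space X_z is homeomorphic to a sphere Metric.sphere (0 : EuclideanSpace ℝ (Fin (m+1))) 1 for some m ≥ 0. Then there is a partition of Fin n into nonempty blocks B₁, …, B_l such that for each k the set of columns {(i ↦ (z i j : ℚ)) | j ∈ B_k} is minimally dependent over ℚ (a circuit) and r = n − l (i.e. the column matroid of z is a direct sum of circuits). -/
open scoped BigOperators

noncomputable section

/-- The sphere `S^{2n-1}`, realized as the unit sphere of `ℂ^n`. -/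
abbrev Sph (n : ℕ) : Type := Metric.sphere (0 : EuclideanSpace ℂ (Fin n)) 1

/-- The element of the circle by which `t ∈ T^r = (Fin r → Circle)` acts on the `j`-th
coordinate of `ℂ^n`, namely `∏ i, (t i) ^ (z i j)`. -/
def weightProd {n r : ℕ} (z : Fin r → Fin n → ℤ) (t : Fin r → Circle) (j : Fin n) : Circle :=
  ∏ i, t i ^ z i j

/-- The orbit equivalence relation on `S^{2n-1}` for the linear torus action with weight
matrix `z`:  `x ≈ y` iff some `t ∈ T^r` moves `x` to `y`, where `(t • x) j = (∏ i, (t i)^(z i j)) • (x j)`. -/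
def orbitSetoid {n r : ℕ} (z : Fin r → Fin n → ℤ) : Setoid (Sph n) where
  r x y := ∃ t : Fin r → Circle,
    ∀ j, (weightProd z t j : ℂ) * (x : EuclideanSpace ℂ (Fin n)) j
      = (y : EuclideanSpace ℂ (Fin n)) j
  iseqv := by
    constructor
    · intro x
      exact ⟨1, fun j => by simp [weightProd]⟩
    · rintro x y ⟨t, ht⟩
      refine ⟨fun i => (t i)⁻¹, fun j => ?_⟩
      have h : weightProd z (fun i => (t i)⁻¹) j = (weightProd z t j)⁻¹ := by
        simp only [weightProd, inv_zpow]
        exact Finset.prod_inv_distrib _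
      rw [h, ← ht j, Circle.coe_inv, inv_mul_cancel_left₀ (Circle.coe_ne_zero _)]
    · rintro x y zz ⟨t, ht⟩ ⟨s, hs⟩
      refine ⟨t * s, fun j => ?_⟩
      have h : weightProd z (t * s) j = weightProd z t j * weightProd z s j := by
        simp [weightProd, mul_zpow, Finset.prod_mul_distrib]
      rw [h, ← hs j, ← ht j]
      push_cast
      ring

/-- The orbit space `X_z = S^{2n-1}/T^r` of the linear torus action with weight matrix `z`,
equipped with the quotient topology. -/
abbrev OrbitSpace {n r : ℕ} (z : Fin r → Fin n → ℤ) : Type := Quotient (orbitSetoid z)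

/-- The set of columns of `z` indexed by `B` is minimally dependent over `ℚ` (a circuit):
it is ℚ-linearly dependent, but every proper subset of it is ℚ-linearly independent. -/
def IsCircuitOfCols {n r : ℕ} (z : Fin r → Fin n → ℤ) (B : Finset (Fin n)) : Prop :=
  ¬ LinearIndependent ℚ (fun j : B => fun i => (z i (j : Fin n) : ℚ)) ∧
    ∀ C : Finset (Fin n), C ⊂ B →
      LinearIndependent ℚ (fun j : C => fun i => (z i (j : Fin n) : ℚ))

/-- The column matroid of `z` is a direct sum of circuits: `Fin n` can be partitioned into
nonempty blocks, each of which indexes a circuit of columns, with `r = n - l` where `l` is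
the number of blocks. -/
def IsSumOfCircuits {n r : ℕ} (z : Fin r → Fin n → ℤ) : Prop :=
  ∃ (l : ℕ) (B : Fin l → Finset (Fin n)),
    (∀ k, (B k).Nonempty) ∧ (∀ k, IsCircuitOfCols z (B k)) ∧
    (∀ k k', k ≠ k' → Disjoint (B k) (B k')) ∧ (∀ j, ∃ k, j ∈ B k) ∧ r = n - l

section PartA
open MeasureTheory

theorem det_interp {V : Type*} [NormedAddCommGroup V] [NormedSpace ℝ V] [FiniteDimensional ℝ V]
    (ε : ℝ) (hε : 0 < ε) :
    ∃ (t L : Fin (Module.finrank ℝ V + 1) → ℝ), (∀ i, |t i| < ε) ∧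
      ∀ A : V →L[ℝ] V, A.det = ∑ i, L i * (1 + t i • A).det := by
  classical
  set d := Module.finrank ℝ V with hd
  let t : Fin (d + 1) → ℝ := fun i => ε * ((i : ℕ) / (d + 1 : ℝ))
  have htinj : Function.Injective t := by
    intro i j hij
    have h1 : (d + 1 : ℝ) ≠ 0 := by positivity
    have : ((i : ℕ) : ℝ) = (j : ℕ) := by
      have h2 := mul_left_cancel₀ hε.ne' hij
      field_simp at h2
      exact h2
    exact Fin.ext (by exact_mod_cast this)
  refine ⟨t, fun i => (Lagrange.basis Finset.univ t i).coeff d, ?_, ?_⟩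
  · intro i
    have h1 : (0 : ℝ) < d + 1 := by positivity
    have h2 : ((i : ℕ) : ℝ) < d + 1 := by exact_mod_cast i.2
    have h3 : ((i : ℕ) : ℝ) / (d + 1) < 1 := by rw [div_lt_one h1]; exact h2
    have h4 : 0 ≤ ((i : ℕ) : ℝ) / (d + 1) := by positivity
    rw [abs_of_nonneg (by positivity)]
    nlinarith
  · intro A
    let b := Module.finBasis ℝ V
    let M : Matrix (Fin d) (Fin d) ℝ := LinearMap.toMatrix b b (A : V →ₗ[ℝ] V)
    have hA : A.det = M.det := by
      simp only [M]
      rw [LinearMap.det_toMatrix]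
    have hAt : ∀ s : ℝ, (1 + s • A).det = (s • M + 1).det := by
      intro s
      have : s • M + 1 = LinearMap.toMatrix b b ((1 + s • A : V →L[ℝ] V) : V →ₗ[ℝ] V) := by
        have e : ((1 + s • A : V →L[ℝ] V) : V →ₗ[ℝ] V) = LinearMap.id + s • (A : V →ₗ[ℝ] V) := by
          ext; simp
        rw [e, map_add, map_smul, LinearMap.toMatrix_id, add_comm]
      rw [this, LinearMap.det_toMatrix]
    let p : Polynomial ℝ := ((Polynomial.X : Polynomial ℝ) • M.map (Polynomial.C : ℝ →+* Polynomial ℝ) + (1 : Matrix (Fin d) (Fin d) ℝ).map (Polynomial.C : ℝ →+* Polynomial ℝ)).det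
    have hpe : ∀ s, p.eval s = (1 + s • A).det := by
      intro s
      rw [hAt]
      simp only [p]
      have := (RingHom.map_det (Polynomial.evalRingHom s) ((Polynomial.X : Polynomial ℝ) • M.map (Polynomial.C : ℝ →+* Polynomial ℝ) + (1 : Matrix (Fin d) (Fin d) ℝ).map (Polynomial.C : ℝ →+* Polynomial ℝ)))
      simp only [Polynomial.coe_evalRingHom] at this
      rw [this]
      congr 1
      ext i j
      by_cases h : i = j <;> simp [h] <;> ring
    have hpd : p.degree < ((Finset.univ : Finset (Fin (d+1))).card : ℕ) := by
      refine lt_of_le_of_lt Polynomial.degree_le_natDegree ?_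
      have := Polynomial.natDegree_det_X_add_C_le M 1
      rw [Fintype.card_fin] at this
      rw [Finset.card_univ, Fintype.card_fin]
      exact_mod_cast Nat.lt_succ_of_le this
    have hpc : p.coeff d = M.det := by
      have := Polynomial.coeff_det_X_add_C_card M 1
      rwa [Fintype.card_fin] at this
    have hint := Lagrange.eq_interpolate_of_eval_eq (s := Finset.univ) (v := t)
      (fun i => (1 + t i • A).det) htinj.injOn hpd (fun i _ => hpe _)
    rw [hA, ← hpc]
    conv_lhs => rw [hint]
    rw [Lagrange.interpolate_apply, Polynomial.finsetSum_coeff]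
    refine Finset.sum_congr rfl fun i _ => ?_
    rw [Polynomial.coeff_C_mul, mul_comm]

theorem pert_image {V : Type*} [NormedAddCommGroup V] [NormedSpace ℝ V] [FiniteDimensional ℝ V]
    (w : V → V) (C : NNReal) (hC : C < 1) (hL : LipschitzWith C w) (B : Set V)
    (hB : ∀ x, x ∉ B → w x = 0) :
    Function.Injective (fun x => x + w x) ∧ (fun x => x + w x) '' B = B := by
  have happ : ApproximatesLinearOn (fun x => x + w x) ((ContinuousLinearEquiv.refl ℝ V : V ≃L[ℝ] V) : V →L[ℝ] V) Set.univ C := by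
    intro x _ y _
    have := hL.dist_le_mul x y
    rw [dist_eq_norm, dist_eq_norm] at this
    simpa [add_sub_add_comm] using this
  have hbij : Function.Bijective (fun x => x + w x) := by
    rcases subsingleton_or_nontrivial V with h | h
    · exact (happ.toHomeomorph _ (Or.inl h)).bijective
    · refine (happ.toHomeomorph _ (Or.inr ?_)).bijective
      have : ‖(((ContinuousLinearEquiv.refl ℝ V).symm : V ≃L[ℝ] V) : V →L[ℝ] V)‖₊ = 1 := by
        ext; exact ContinuousLinearMap.norm_id
      rw [this]; simpa using hC
  refine ⟨hbij.1, ?_⟩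
  have hc : (fun x => x + w x) '' Bᶜ = Bᶜ := by
    ext y; constructor
    · rintro ⟨x, hx, rfl⟩; simpa [hB x hx] using hx
    · intro hy; exact ⟨y, hy, by simp [hB y hy]⟩
  have := Set.image_compl_eq (s := Bᶜ) hbij
  rw [hc, compl_compl] at this
  exact this

theorem int_det_zero {V : Type*} [NormedAddCommGroup V] [NormedSpace ℝ V] [FiniteDimensional ℝ V]
    [MeasurableSpace V] [BorelSpace V] [Nontrivial V] (μ : Measure V) [μ.IsAddHaarMeasure]
    (w : V → V) (hw : ContDiff ℝ 1 w) (hc : HasCompactSupport w) :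
    ∫ x, (fderiv ℝ w x).det ∂μ = 0 := by
  obtain ⟨C, hC⟩ := ContDiff.lipschitzWith_of_hasCompactSupport hc hw one_ne_zero
  obtain ⟨R, hR⟩ := (hc.isCompact.isBounded).subset_closedBall (0 : V)
  set B := Metric.closedBall (0 : V) R with hBdef
  have hcd : Continuous (fderiv ℝ w) := hw.continuous_fderiv one_ne_zero
  have hD : ∀ x, ‖fderiv ℝ w x‖ ≤ C := fun x => norm_fderiv_le_of_lipschitz ℝ hC
  -- positivity
  have hpos : ∃ ε > 0, ∀ A : V →L[ℝ] V, ‖A‖ < ε → 0 < (1 + A).det := by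
    have hcont : Continuous fun A : V →L[ℝ] V => (1 + A).det :=
      ContinuousLinearMap.continuous_det.comp (continuous_const.add continuous_id)
    have h0 : (0 : ℝ) < (1 + (0 : V →L[ℝ] V)).det := by
      rw [add_zero]; simp [ContinuousLinearMap.det]
    have := hcont.continuousAt.eventually (lt_mem_nhds h0)
    obtain ⟨ε, hε, h⟩ := Metric.eventually_nhds_iff.1 this
    exact ⟨ε, hε, fun A hA => h (by simpa using hA)⟩
  obtain ⟨ε, hε, hpos⟩ := hpos
  set δ := min 1 ε / (C + 1) with hδ
  have hδpos : 0 < δ := by positivity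
  obtain ⟨t, L, ht, hdet⟩ := det_interp (V := V) δ hδpos
  have hsmall : ∀ i, |t i| * C < 1 ∧ |t i| * C < ε := by
    intro i
    have h1 := ht i
    have h2 : |t i| * (C + 1) < min 1 ε := by rwa [hδ, lt_div_iff₀ (by positivity)] at h1
    have h3 := abs_nonneg (t i)
    constructor
    · have := min_le_left 1 ε; nlinarith
    · have := min_le_right 1 ε; nlinarith
  have key : ∀ i, ∫ x in B, (1 + t i • fderiv ℝ w x).det ∂μ = μ.real B := by
    intro i
    have hLip : LipschitzWith (Real.nnabs (t i) * C) (fun x => t i • w x) := by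
      apply LipschitzWith.of_dist_le_mul
      intro x y
      rw [dist_smul₀]
      have := hC.dist_le_mul x y
      simp only [NNReal.coe_mul, Real.coe_nnabs, Real.norm_eq_abs]
      rw [mul_assoc]
      exact mul_le_mul_of_nonneg_left this (abs_nonneg _)
    have hp := pert_image (fun x => t i • w x) _ (by rw [← NNReal.coe_lt_coe]; simpa using (hsmall i).1) hLip B (by
      intro x hx
      have : w x = 0 := by
        by_contra h
        exact hx (hR (subset_tsupport _ h))
      simp [this])
    have hder : ∀ x ∈ B, HasFDerivWithinAt (fun x => x + t i • w x) (1 + t i • fderiv ℝ w x) B x := by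
      intro x _
      have h1 := ((hw.differentiable one_ne_zero) x).hasFDerivAt
      exact ((hasFDerivAt_id x).add (h1.const_smul (t i))).hasFDerivWithinAt
    have := integral_image_eq_integral_abs_det_fderiv_smul μ (measurableSet_closedBall)
      hder hp.1.injOn (fun _ => (1 : ℝ))
    rw [hp.2] at this
    simp only [smul_eq_mul, mul_one] at this
    rw [integral_const] at this
    simp only [smul_eq_mul, mul_one, measureReal_restrict_apply_univ] at this
    rw [this]
    apply integral_congr_ae
    refine Filter.Eventually.of_forall fun x => ?_
    have : 0 < (1 + t i • fderiv ℝ w x).det := by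
      apply hpos
      rw [norm_smul, Real.norm_eq_abs]
      exact lt_of_le_of_lt (mul_le_mul_of_nonneg_left (hD x) (abs_nonneg _)) (hsmall i).2
    simp only
    rw [abs_of_pos this]
  have hdz : (0 : V →L[ℝ] V).det = 0 := by
    simp only [ContinuousLinearMap.det, ContinuousLinearMap.toLinearMap_zero]
    rw [LinearMap.det_zero, zero_pow (Module.finrank_pos.ne')]
  have hsupp : ∫ x, (fderiv ℝ w x).det ∂μ = ∫ x in B, (fderiv ℝ w x).det ∂μ := by
    symm
    apply setIntegral_eq_integral_of_forall_compl_eq_zero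
    intro x hx
    have : fderiv ℝ w x = 0 := by
      by_contra h
      exact hx (hR (support_fderiv_subset ℝ h))
    rw [this, hdz]
  rw [hsupp]
  simp_rw [hdet (fderiv ℝ w _)]
  rw [integral_finsetSum]
  · simp_rw [integral_const_mul, key]
    have h0 := hdet 0
    rw [hdz] at h0
    have h1 : (1 : V →L[ℝ] V).det = 1 := by simp [ContinuousLinearMap.det]
    simp only [smul_zero, add_zero, h1, mul_one] at h0
    rw [← Finset.sum_mul, ← h0, zero_mul]
  · intro i _
    have : Continuous fun x => L i * (1 + t i • fderiv ℝ w x).det := by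
      refine continuous_const.mul (ContinuousLinearMap.continuous_det.comp ?_)
      fun_prop
    exact (this.continuousOn.integrableOn_compact (isCompact_closedBall _ _))
end PartA

section PartB
open MeasureTheory

theorem int_det_eq {V : Type*} [NormedAddCommGroup V] [NormedSpace ℝ V] [FiniteDimensional ℝ V]
    [MeasurableSpace V] [BorelSpace V] [Nontrivial V] (μ : Measure V) [μ.IsAddHaarMeasure]
    (A A' : V → V) (hA : ContDiff ℝ 1 A) (hA' : ContDiff ℝ 1 A') (R : ℝ) (hR : 0 < R)
    (h : ∀ x, R < ‖x‖ → A x = A' x) :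
    ∫ x in Metric.closedBall (0 : V) R, (fderiv ℝ A x).det ∂μ
      = ∫ x in Metric.closedBall (0 : V) R, (fderiv ℝ A' x).det ∂μ := by
  let χ : ContDiffBump (0 : V) := ⟨R + 1, R + 2, by linarith, by linarith⟩
  have hd0 : (0 : V →L[ℝ] V).det = 0 := by
    simp only [ContinuousLinearMap.det, ContinuousLinearMap.toLinearMap_zero]
    rw [LinearMap.det_zero, zero_pow (Module.finrank_pos.ne')]
  have main : ∀ A : V → V, ContDiff ℝ 1 A →
      ∫ x in Metric.closedBall (0 : V) R, (fderiv ℝ A x).det ∂μ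
        + ∫ x in (Metric.closedBall (0 : V) R)ᶜ, (fderiv ℝ (fun x => χ x • A x) x).det ∂μ = 0 := by
    intro A hA
    have hw : ContDiff ℝ 1 (fun x => χ x • A x) := χ.contDiff.smul hA
    have hcs : HasCompactSupport (fun x => χ x • A x) := χ.hasCompactSupport.smul_right
    have h0 := int_det_zero μ _ hw hcs
    have hcont : Continuous fun x => (fderiv ℝ (fun x => χ x • A x) x).det :=
      ContinuousLinearMap.continuous_det.comp (hw.continuous_fderiv one_ne_zero)
    have hint : Integrable (fun x => (fderiv ℝ (fun x => χ x • A x) x).det) μ := by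
      apply hcont.integrable_of_hasCompactSupport
      refine HasCompactSupport.intro (hcs.fderiv (𝕜 := ℝ)).isCompact ?_
      intro x hx
      have : fderiv ℝ (fun x => χ x • A x) x = 0 := image_eq_zero_of_notMem_tsupport hx
      rw [this, hd0]
    rw [← integral_add_compl (measurableSet_closedBall (x := (0 : V)) (ε := R)) hint] at h0
    rw [← h0]
    congr 1
    apply setIntegral_congr_fun measurableSet_closedBall
    intro x hx
    have : (fun x => χ x • A x) =ᶠ[nhds x] A := by
      have : ∀ᶠ y in nhds x, y ∈ Metric.ball (0 : V) (R + 1) := by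
        apply Metric.isOpen_ball.mem_nhds
        exact Metric.closedBall_subset_ball (by linarith) hx
      filter_upwards [this] with y hy
      rw [χ.one_of_mem_closedBall (Metric.ball_subset_closedBall hy), one_smul]
    simp only
    rw [this.fderiv_eq]
  have h1 := main A hA
  have h2 := main A' hA'
  have h3 : ∫ x in (Metric.closedBall (0 : V) R)ᶜ, (fderiv ℝ (fun x => χ x • A x) x).det ∂μ
      = ∫ x in (Metric.closedBall (0 : V) R)ᶜ, (fderiv ℝ (fun x => χ x • A' x) x).det ∂μ := by
    apply setIntegral_congr_fun measurableSet_closedBall.compl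
    intro x hx
    have : (fun x => χ x • A x) =ᶠ[nhds x] (fun x => χ x • A' x) := by
      filter_upwards [Metric.isClosed_closedBall.isOpen_compl.mem_nhds hx] with y hy
      rw [h y (by simpa using hy)]
    simp only
    rw [this.fderiv_eq]
  linarith

theorem exists_tent (c η : ℝ) (hη : 0 < η) : ∃ σ σ' : ℝ → ℝ, Continuous σ' ∧
    (∀ x, HasDerivAt σ (σ' x) x) ∧ (∀ x, 0 ≤ σ' x) ∧ 0 < σ' c ∧ ∀ x, η ≤ |x - c| → σ' x = 0 := by
  let σ' : ℝ → ℝ := fun x => max 0 (η - |x - c|)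
  have hc : Continuous σ' := by fun_prop
  refine ⟨fun x => ∫ y in (0 : ℝ)..x, σ' y, σ', hc, fun x => ?_, fun x => le_max_left _ _, ?_, ?_⟩
  · exact intervalIntegral.integral_hasDerivAt_right (hc.intervalIntegrable _ _)
      hc.stronglyMeasurable.stronglyMeasurableAtFilter hc.continuousAt
  · simp [σ', hη]
  · intro x hx
    simp [σ', hx]

theorem exists_theta {V : Type*} [NormedAddCommGroup V] [NormedSpace ℝ V] [FiniteDimensional ℝ V]
    (y0 : V) (ε : ℝ) (hε : 0 < ε) : ∃ Θ : V → V, ContDiff ℝ 1 Θ ∧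
      (∀ y, 0 ≤ (fderiv ℝ Θ y).det) ∧ 0 < (fderiv ℝ Θ y0).det ∧
      ∀ y, ε ≤ ‖y - y0‖ → (fderiv ℝ Θ y).det = 0 := by
  let e : V ≃L[ℝ] (Fin (Module.finrank ℝ V) → ℝ) :=
    ContinuousLinearEquiv.ofFinrankEq (by simp)
  set L := ‖(e.symm : (Fin (Module.finrank ℝ V) → ℝ) →L[ℝ] V)‖ with hL
  set η := ε / (L + 1) with hηd
  have hLn : 0 ≤ L := norm_nonneg _
  have hη : 0 < η := by positivity
  choose σ σ' h1 h2 h3 h4 h5 using fun i => exists_tent (e y0 i) η hη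
  let D : V → V →L[ℝ] V := fun y =>
    (e.symm : (Fin (Module.finrank ℝ V) → ℝ) →L[ℝ] V) ∘L
      (ContinuousLinearMap.pi fun i => (σ' i (e y i) • ContinuousLinearMap.id ℝ ℝ) ∘L ContinuousLinearMap.proj i) ∘L
      (e : V →L[ℝ] (Fin (Module.finrank ℝ V) → ℝ))
  let Θ : V → V := fun y => e.symm (fun i => σ i (e y i))
  have hD : ∀ y, HasFDerivAt Θ (D y) y := by
    intro y
    have hpi : HasFDerivAt (fun (z : Fin (Module.finrank ℝ V) → ℝ) i => σ i (z i))
        (ContinuousLinearMap.pi fun i => (σ' i (e y i) • ContinuousLinearMap.id ℝ ℝ) ∘L ContinuousLinearMap.proj i) (e y) := by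
      rw [hasFDerivAt_pi]
      intro i
      have := ((h2 i (e y i)).hasFDerivAt).comp (e y) (ContinuousLinearMap.proj (R := ℝ) (φ := fun _ : Fin (Module.finrank ℝ V) => ℝ) i).hasFDerivAt
      have he : (σ' i (e y i) • ContinuousLinearMap.id ℝ ℝ) ∘L ContinuousLinearMap.proj (R := ℝ) (φ := fun _ : Fin (Module.finrank ℝ V) => ℝ) i =
          ContinuousLinearMap.toSpanSingleton ℝ (σ' i (e y i)) ∘L ContinuousLinearMap.proj i := by
        refine ContinuousLinearMap.ext fun v => ?_
        simp [mul_comm]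
      rw [he]
      exact this
    exact e.symm.hasFDerivAt.comp y (hpi.comp y e.hasFDerivAt)
  have hfd : fderiv ℝ Θ = D := by ext1 y; exact (hD y).fderiv
  have hdet : ∀ y, (fderiv ℝ Θ y).det = ∏ i, σ' i (e y i) := by
    intro y
    rw [hfd]
    have := LinearMap.det_conj (LinearMap.pi fun i => (σ' i (e y i) • (LinearMap.id : ℝ →ₗ[ℝ] ℝ)) ∘ₗ LinearMap.proj i) e.symm.toLinearEquiv
    rw [LinearMap.det_pi] at this
    simp only [LinearMap.det_smul, LinearMap.det_id, mul_one, Module.finrank_self, pow_one] at this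
    rw [← this]
    rfl
  refine ⟨Θ, ?_, ?_, ?_, ?_⟩
  · rw [contDiff_one_iff_fderiv]
    refine ⟨fun y => (hD y).differentiableAt, ?_⟩
    rw [hfd]
    have : Continuous fun y => (ContinuousLinearMap.pi fun i => (σ' i (e y i) • ContinuousLinearMap.id ℝ ℝ) ∘L ContinuousLinearMap.proj (R := ℝ) (φ := fun _ : Fin (Module.finrank ℝ V) => ℝ) i) := by
      rw [continuous_clm_apply]
      intro z
      rw [continuous_pi_iff]
      intro i
      have hci := h1 i
      have : Continuous fun y => σ' i (e y i) := hci.comp ((continuous_apply i).comp e.continuous)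
      simp only [ContinuousLinearMap.coe_pi', ContinuousLinearMap.comp_apply, smul_apply, ContinuousLinearMap.id_apply, smul_eq_mul]
      exact this.mul continuous_const
    exact continuous_const.clm_comp (this.clm_comp continuous_const)
  · intro y; rw [hdet]; exact Finset.prod_nonneg fun i _ => h3 i _
  · rw [hdet]; exact Finset.prod_pos fun i _ => h4 i
  · intro y hy
    rw [hdet]
    have : ∃ i, η ≤ |e y i - e y0 i| := by
      by_contra hcon
      push Not at hcon
      have hn : ‖e y - e y0‖ ≤ η := by
        rw [pi_norm_le_iff_of_nonneg hη.le]
        intro i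
        simpa using (hcon i).le
      have h6 : ‖y - y0‖ ≤ L * η := by
        have := (e.symm : (Fin (Module.finrank ℝ V) → ℝ) →L[ℝ] V).le_opNorm (e y - e y0)
        simp only [map_sub, ContinuousLinearEquiv.coe_coe, ContinuousLinearEquiv.symm_apply_apply] at this
        refine this.trans ?_
        gcongr
      have : L * η < ε := by
        rw [hηd, ← mul_div_assoc, div_lt_iff₀ (by positivity)]
        nlinarith
      linarith
    obtain ⟨i, hi⟩ := this
    exact Finset.prod_eq_zero (Finset.mem_univ i) (h5 i _ hi)

/-- Maps to which the degree argument applies. -/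
def GoodMap {V : Type*} [NormedAddCommGroup V] [NormedSpace ℝ V] (P : V → V) : Prop :=
  ContDiff ℝ 1 P ∧ (∀ x, 0 ≤ (fderiv ℝ P x).det) ∧
    ∀ ε > 0, ∃ x, ‖x‖ ≤ 1 ∧ ‖P x‖ < ε ∧ 0 < (fderiv ℝ P x).det

theorem degree_zero {V : Type*} [NormedAddCommGroup V] [NormedSpace ℝ V] [FiniteDimensional ℝ V]
    [Nontrivial V] (P G : V → V) (hP : GoodMap P) (hG : Continuous G) (R : ℝ)
    (hGP : ∀ x, R < ‖x‖ → G x = P x) : ∃ x, G x = 0 := by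
  by_contra hne
  push Not at hne
  obtain ⟨hP1, hP2, hP3⟩ := hP
  set R' := max R 2 with hR'
  have hR'pos : 0 < R' := by positivity
  let _ : MeasurableSpace V := borel V
  have : BorelSpace V := ⟨rfl⟩
  let μ : Measure V := Measure.addHaar
  obtain ⟨δ, hδ, hδG⟩ : ∃ δ > 0, ∀ x ∈ Metric.closedBall (0 : V) R', δ ≤ ‖G x‖ := by
    obtain ⟨x, hx, hmin⟩ := (isCompact_closedBall (0 : V) R').exists_isMinOn
      ⟨0, by simp [hR'pos.le]⟩ hG.norm.continuousOn
    exact ⟨‖G x‖, norm_pos_iff.2 (hne x), fun y hy => hmin hy⟩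
  obtain ⟨g, hg1, hg2, hg3⟩ := (hG.sub hP1.continuous).exists_contDiff_approx 1
    (ε := fun _ => δ / 3) continuous_const (fun _ => by positivity)
  obtain ⟨x0, hx0, hPx0, hdx0⟩ := hP3 (δ / 3) (by positivity)
  obtain ⟨Θ, hΘ1, hΘ2, hΘ3, hΘ4⟩ := exists_theta (P x0) (δ / 3) (by positivity)
  have hG' : ContDiff ℝ 1 (fun x => P x + g x) := hP1.add hg1
  have heq := int_det_eq μ (fun x => Θ (P x)) (fun x => Θ (P x + g x)) (hΘ1.comp hP1)
    (hΘ1.comp hG') R' hR'pos (by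
      intro x hx
      have hgx : g x = 0 := by
        by_contra h
        have := hg3 h
        apply this
        simp [hGP x (lt_of_le_of_lt (le_max_left _ _) hx)]
      simp [hgx])
  have hchain : ∀ Q : V → V, ContDiff ℝ 1 Q → ∀ x, (fderiv ℝ (fun x => Θ (Q x)) x).det
      = (fderiv ℝ Θ (Q x)).det * (fderiv ℝ Q x).det := by
    intro Q hQ x
    have := fderiv_comp x (hΘ1.differentiable one_ne_zero (Q x)) (hQ.differentiable one_ne_zero x)
    have h' : (fun x => Θ (Q x)) = Θ ∘ Q := rfl
    rw [h', this]
    exact LinearMap.det_comp _ _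
  have hz : ∫ x in Metric.closedBall (0 : V) R', (fderiv ℝ (fun x => Θ (P x + g x)) x).det ∂μ = 0 := by
    apply setIntegral_eq_zero_of_forall_eq_zero
    intro x hx
    rw [hchain _ hG', hΘ4, zero_mul]
    have h1 := hδG x hx
    have h2 := hg2 x
    rw [dist_eq_norm] at h2
    have h3 : G x = (P x + g x - P x0) + P x0 - (g x - (G x - P x)) := by abel
    have h4 : ‖G x‖ ≤ ‖P x + g x - P x0‖ + ‖P x0‖ + ‖g x - (G x - P x)‖ := by
      conv_lhs => rw [h3]
      exact (norm_sub_le _ _).trans (add_le_add_left (norm_add_le _ _) _)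
    simp only [Pi.sub_apply] at h2
    linarith
  rw [hz] at heq
  set φ : V → ℝ := fun x => (fderiv ℝ (fun x => Θ (P x)) x).det with hφ
  have hφc : Continuous φ :=
    ContinuousLinearMap.continuous_det.comp ((hΘ1.comp hP1).continuous_fderiv one_ne_zero)
  have hφ0 : ∀ x, 0 ≤ φ x := fun x => by
    rw [hφ]; simp only; rw [hchain P hP1]; exact mul_nonneg (hΘ2 _) (hP2 _)
  have hφx0 : 0 < φ x0 := by
    rw [hφ]; simp only; rw [hchain P hP1]; exact mul_pos hΘ3 hdx0
  have hpos : 0 < ∫ x in Metric.closedBall (0 : V) R', φ x ∂μ := by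
    rw [setIntegral_pos_iff_support_of_nonneg_ae (Filter.Eventually.of_forall hφ0)
      (hφc.continuousOn.integrableOn_compact (isCompact_closedBall _ _))]
    have hopen : IsOpen (Function.support φ ∩ Metric.ball 0 R') :=
      (hφc.isOpen_support).inter Metric.isOpen_ball
    refine lt_of_lt_of_le (hopen.measure_pos μ ⟨x0, hφx0.ne', ?_⟩)
      (measure_mono (Set.inter_subset_inter_right _ Metric.ball_subset_closedBall))
    rw [mem_ball_zero_iff]
    have : (2 : ℝ) ≤ R' := le_max_right _ _
    linarith
  exact hpos.ne' heq

theorem avoid {V W : Type*} [NormedAddCommGroup V] [NormedSpace ℝ V] [FiniteDimensional ℝ V]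
    [NormedAddCommGroup W] [NormedSpace ℝ W] [FiniteDimensional ℝ W]
    (hVW : Module.finrank ℝ V < Module.finrank ℝ W) (f : V → W) (hf : Continuous f)
    (η : ℝ) (hη : 0 < η) : ∃ h : V → W, Continuous h ∧ (∀ x, ‖h x - f x‖ < η) ∧ ∀ x, h x ≠ 0 := by
  obtain ⟨g, hg1, hg2, -⟩ := hf.exists_contDiff_approx 1
    (ε := fun _ => η / 2) continuous_const (fun _ => by positivity)
  have hd := ContDiff.dense_compl_range_of_finrank_lt_finrank hg1 hVW
  obtain ⟨c, hc1, hc2⟩ := hd.exists_dist_lt 0 (show (0 : ℝ) < η / 2 by positivity)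
  refine ⟨fun x => g x - c, hg1.continuous.sub continuous_const, ?_, ?_⟩
  · intro x
    have h1 := hg2 x
    rw [dist_eq_norm] at h1
    rw [dist_zero_left] at hc2
    have : g x - c - f x = (g x - f x) - c := by abel
    rw [this]
    have := norm_sub_le (g x - f x) c
    linarith
  · intro x hx
    exact hc1 ⟨x, sub_eq_zero.1 hx⟩

theorem essential {V : Type*} [NormedAddCommGroup V] [NormedSpace ℝ V] [FiniteDimensional ℝ V]
    [Nontrivial V] (P f0 : V → V) (hP : GoodMap P) (hf0 : Continuous f0)
    (H : ∀ v, v ≠ 0 → ∀ τ : ℝ, 0 ≤ τ → τ ≤ 1 → (1 - τ) • f0 v + τ • P v ≠ 0) :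
    ∃ η > 0, ∀ h : V → V, Continuous h → (∀ x, 1 ≤ ‖x‖ → ‖x‖ ≤ 2 → ‖h x - f0 x‖ < η) →
      ∃ x, h x = 0 := by
  let τ : V → ℝ := fun x => max 0 (min 1 (‖x‖ - 1))
  have hτc : Continuous τ := by fun_prop
  have hτ0 : ∀ x, 0 ≤ τ x := fun x => le_max_left _ _
  have hτ1 : ∀ x, τ x ≤ 1 := fun x => max_le zero_le_one (min_le_left _ _)
  have hPc := hP.1.continuous
  obtain ⟨η, hη, hmin⟩ : ∃ η > 0, ∀ x : V, 1 ≤ ‖x‖ → ‖x‖ ≤ 2 →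
      η ≤ ‖(1 - τ x) • f0 x + τ x • P x‖ := by
    have hcpt : IsCompact {x : V | 1 ≤ ‖x‖ ∧ ‖x‖ ≤ 2} := by
      refine (isCompact_closedBall (0 : V) 2).of_isClosed_subset ?_ ?_
      · exact (isClosed_le continuous_const continuous_norm).inter
          (isClosed_le continuous_norm continuous_const)
      · intro x hx; simpa using hx.2
    have hc : Continuous fun x => ‖(1 - τ x) • f0 x + τ x • P x‖ := by fun_prop
    by_cases hemp : {x : V | 1 ≤ ‖x‖ ∧ ‖x‖ ≤ 2}.Nonempty
    · obtain ⟨x, hx, hm⟩ := hcpt.exists_isMinOn hemp hc.continuousOn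
      refine ⟨_, norm_pos_iff.2 (H x ?_ (τ x) (hτ0 x) (hτ1 x)), fun y h1 h2 => hm ⟨h1, h2⟩⟩
      rintro rfl
      have := hx.1
      simp at this
      linarith
    · refine ⟨1, one_pos, fun x h1 h2 => (hemp ⟨x, h1, h2⟩).elim⟩
  refine ⟨η, hη, fun h hh hclose => ?_⟩
  obtain ⟨x, hx⟩ := degree_zero P (fun x => (1 - τ x) • h x + τ x • P x) hP (by fun_prop) 2 (by
    intro x hx
    have : τ x = 1 := by
      simp only [τ]
      rw [min_eq_left (by linarith), max_eq_right zero_le_one]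
    simp [this])
  refine ⟨x, ?_⟩
  rcases lt_or_ge ‖x‖ 1 with h1 | h1
  · have : τ x = 0 := by
      simp only [τ]
      exact max_eq_left ((min_le_right _ _).trans (by linarith))
    simpa [this] using hx
  rcases le_or_gt ‖x‖ 2 with h2 | h2
  · exfalso
    have ha := hmin x h1 h2
    have hb := hclose x h1 h2
    have : (1 - τ x) • f0 x + τ x • P x = -((1 - τ x) • (h x - f0 x)) := by
      have hx' : (1 - τ x) • h x + τ x • P x = 0 := hx
      rw [smul_sub, neg_sub, eq_sub_iff_add_eq]
      calc _ = ((1 - τ x) • h x + τ x • P x) + (1 - τ x) • f0 x := by abel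
        _ = _ := by rw [hx', zero_add]
    rw [this, norm_neg, norm_smul, Real.norm_eq_abs, abs_of_nonneg (by linarith [hτ1 x])] at ha
    nlinarith [hτ0 x, norm_nonneg (h x - f0 x)]
  · exfalso
    have : τ x = 1 := by
      simp only [τ]
      rw [min_eq_left (by linarith), max_eq_right zero_le_one]
    have h3 := H x (by rintro rfl; simp at h2; linarith) 1 zero_le_one le_rfl
    simp [this] at hx
    simp [hx] at h3
end PartB

section PartC
theorem GoodMap.id {V : Type*} [NormedAddCommGroup V] [NormedSpace ℝ V] :
    GoodMap (fun x : V => x) := by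
  have h : ∀ x : V, (fderiv ℝ (fun x : V => x) x).det = 1 := by
    intro x
    have : fderiv ℝ (fun x : V => x) x = ContinuousLinearMap.id ℝ V := fderiv_fun_id
    rw [this]
    exact LinearMap.det_id
  refine ⟨contDiff_id, fun x => by rw [h]; exact zero_le_one, fun ε hε => ⟨0, by simp, by simpa using hε, by rw [h]; exact one_pos⟩⟩

theorem GoodMap.prod {V W : Type*} [NormedAddCommGroup V] [NormedSpace ℝ V] [FiniteDimensional ℝ V]
    [NormedAddCommGroup W] [NormedSpace ℝ W] [FiniteDimensional ℝ W] {P : V → V} {Q : W → W}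
    (hP : GoodMap P) (hQ : GoodMap Q) : GoodMap (fun x : V × W => (P x.1, Q x.2)) := by
  have h : ∀ x : V × W, (fderiv ℝ (fun x : V × W => (P x.1, Q x.2)) x).det =
      (fderiv ℝ P x.1).det * (fderiv ℝ Q x.2).det := by
    intro x
    have h1 := (hP.1.differentiable one_ne_zero x.1).hasFDerivAt
    have h2 := (hQ.1.differentiable one_ne_zero x.2).hasFDerivAt
    have h3 := HasFDerivAt.prodMap x h1 h2
    have h4 : fderiv ℝ (fun x : V × W => (P x.1, Q x.2)) x = (fderiv ℝ P x.1).prodMap (fderiv ℝ Q x.2) := h3.fderiv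
    rw [h4]
    exact LinearMap.det_prodMap _ _
  refine ⟨(hP.1.comp contDiff_fst).prodMk (hQ.1.comp contDiff_snd), fun x => ?_, fun ε hε => ?_⟩
  · rw [h]; exact mul_nonneg (hP.2.1 _) (hQ.2.1 _)
  · obtain ⟨x, h1, h2, h3⟩ := hP.2.2 ε hε
    obtain ⟨y, k1, k2, k3⟩ := hQ.2.2 ε hε
    refine ⟨(x, y), ?_, ?_, ?_⟩
    · simp [h1, k1]
    · simp [Prod.norm_def, h2, k2]
    · rw [h]; exact mul_pos h3 k3

theorem GoodMap.pi {ι : Type*} [Fintype ι] {V : Type*} [NormedAddCommGroup V] [NormedSpace ℝ V] [FiniteDimensional ℝ V]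
    {P : ι → V → V} (hP : ∀ i, GoodMap (P i)) : GoodMap (fun (x : ι → V) i => P i (x i)) := by
  have h : ∀ x : ι → V, (fderiv ℝ (fun (x : ι → V) i => P i (x i)) x).det =
      ∏ i, (fderiv ℝ (P i) (x i)).det := by
    intro x
    have h3 : HasFDerivAt (fun (x : ι → V) i => P i (x i))
        (ContinuousLinearMap.pi fun i => (fderiv ℝ (P i) (x i)) ∘L ContinuousLinearMap.proj i) x := by
      rw [hasFDerivAt_pi]
      intro i
      exact (((hP i).1.differentiable one_ne_zero (x i)).hasFDerivAt).comp x
        (ContinuousLinearMap.proj (R := ℝ) (φ := fun _ : ι => V) i).hasFDerivAt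
    rw [h3.fderiv]
    exact LinearMap.det_pi _
  refine ⟨contDiff_pi.2 fun i => (hP i).1.comp (contDiff_apply _ _ _), fun x => ?_, fun ε hε => ?_⟩
  · rw [h]; exact Finset.prod_nonneg fun i _ => (hP i).2.1 _
  · choose x h1 h2 h3 using fun i => (hP i).2.2 ε hε
    refine ⟨x, ?_, ?_, ?_⟩
    · rw [pi_norm_le_iff_of_nonneg zero_le_one]; exact h1
    · rw [pi_norm_lt_iff hε]; exact h2
    · rw [h]; exact Finset.prod_pos fun i _ => h3 i

theorem GoodMap.pow (e : ℕ) (he : e ≠ 0) : GoodMap (fun u : ℂ => u ^ e) := by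
  have h : ∀ x : ℂ, (fderiv ℝ (fun u : ℂ => u ^ e) x).det = Complex.normSq (e * x ^ (e - 1)) := by
    intro x
    have h1 := (hasDerivAt_pow e x).hasFDerivAt.restrictScalars ℝ
    rw [h1.fderiv, ← Algebra.norm_complex_apply]
    rw [Algebra.norm_apply]
    unfold ContinuousLinearMap.det
    congr 1
    refine LinearMap.ext fun v => ?_
    simp [mul_comm v]
  have hc : ContDiff ℝ 1 (fun u : ℂ => u ^ e) := contDiff_id.pow e
  refine ⟨hc, fun x => by rw [h]; exact Complex.normSq_nonneg _, fun ε hε => ?_⟩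
  have h0 : Filter.Tendsto (fun u : ℂ => u ^ e) (nhds 0) (nhds 0) := by
    have := hc.continuous.tendsto 0
    simpa [he] using this
  obtain ⟨δ, hδ, hh⟩ := Metric.tendsto_nhds_nhds.1 h0 ε hε
  set t := min (δ / 2) 1 with ht
  have htp : 0 < t := by positivity
  have ht1 : ‖(t : ℂ)‖ = t := by simp [abs_of_pos htp]
  refine ⟨(t : ℂ), ?_, ?_, ?_⟩
  · rw [ht1]; exact min_le_right _ _
  · have := hh (x := (t : ℂ)) (by
      rw [dist_zero_right, ht1]; exact lt_of_le_of_lt (min_le_left _ _) (by linarith))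
    simpa using this
  · rw [h, Complex.normSq_pos]
    have : (t : ℂ) ≠ 0 := by exact_mod_cast htp.ne'
    simp [he, this]
end PartC

section PartD
open ComplexConjugate in
theorem elim_one {ι : Type*} [DecidableEq ι] {V B : Type*} [NormedAddCommGroup V] [NormedSpace ℝ V]
    [FiniteDimensional ℝ V] [NormedAddCommGroup B] [NormedSpace ℝ B] [FiniteDimensional ℝ B]
    (hdim : Module.finrank ℝ V < Module.finrank ℝ B + 4)
    (b : V → B) (y : ι → V → ℂ) (hb : Continuous b)
    (hy : ∀ i j, Continuous fun v => y i v * conj (y j v))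
    (C' : Finset ι) (i1 i2 k : ι) (h12 : i1 ≠ i2) (h1 : i1 ∈ C') (h2 : i2 ∈ C') (hkC : k ∉ C')
    (hnv : ∀ v, b v ≠ 0 ∨ ∃ c ∈ insert k C', y c v ≠ 0)
    (hk : ∀ v, 1 ≤ ‖v‖ → y k v = 0) :
    ∃ (b' : V → B) (y' : ι → V → ℂ), Continuous b' ∧
      (∀ i j, Continuous fun v => y' i v * conj (y' j v)) ∧
      (∀ v, b' v ≠ 0 ∨ ∃ c ∈ C', y' c v ≠ 0) ∧
      (∀ v, 1 ≤ ‖v‖ → b' v = b v ∧ ∀ i, y' i v = y i v) ∧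
      ∀ i, i ≠ i1 → i ≠ i2 → y' i = y i := by
  have hsq : ∀ i v, ‖y i v * conj (y i v)‖ = ‖y i v‖ ^ 2 := by
    intro i v; rw [norm_mul, RCLike.norm_conj, sq]
  have hqc : ∀ i, Continuous fun v => ‖y i v‖ ^ 2 := by
    intro i
    simp_rw [← hsq]
    exact (hy i i).norm
  set q : V → ℝ := fun v => ‖y k v‖ ^ 2 with hq
  have hqcont : Continuous q := hqc k
  let N : V → ℝ := fun v => ‖b v‖ + ∑ c ∈ C', ‖y c v‖ ^ 2
  have hNc : Continuous N := hb.norm.add (continuous_finsetSum _ fun c _ => hqc c)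
  obtain ⟨δ, hδ, hδN⟩ : ∃ δ > 0, ∀ v ∈ Metric.closedBall (0 : V) 1, δ ≤ N v + q v := by
    obtain ⟨x, hx, hmin⟩ := (isCompact_closedBall (0 : V) 1).exists_isMinOn
      ⟨0, by simp⟩ (hNc.add hqcont).continuousOn
    refine ⟨N x + q x, ?_, fun y hy => hmin hy⟩
    have hs0 : 0 ≤ ∑ c ∈ C', ‖y c x‖ ^ 2 := Finset.sum_nonneg fun c _ => by positivity
    have hq0 : 0 ≤ q x := by positivity
    have hb0 := norm_nonneg (b x)
    rcases hnv x with h | ⟨c, hc, h⟩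
    · have := norm_pos_iff.2 h
      simp only [N]; linarith
    · have hp : 0 < ‖y c x‖ ^ 2 := by have := norm_pos_iff.2 h; positivity
      rcases Finset.mem_insert.1 hc with rfl | hc
      · simp only [N]; linarith
      · have := Finset.single_le_sum (f := fun c => ‖y c x‖ ^ 2) (fun c _ => by positivity) hc
        simp only [N]; linarith
  set s : ℝ := δ / 4 with hs
  set η : ℝ := δ / 8 with hη
  have hspos : 0 < s := by positivity
  obtain ⟨h, hhc, hhη, hh0⟩ := avoid (V := V) (W := B × ℂ × ℂ) (by simp [Module.finrank_prod]; omega)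
    (fun v => (b v, y i1 v * conj (y k v), y i2 v * conj (y k v)))
    (hb.prodMk ((hy i1 k).prodMk (hy i2 k))) η (by positivity)
  let χ : V → ℝ := fun v => max 0 (min 1 ((q v - s) / s))
  have hχc : Continuous χ := by fun_prop
  have hχ0 : ∀ v, 0 ≤ χ v := fun v => le_max_left _ _
  have hχ1 : ∀ v, χ v ≤ 1 := fun v => max_le zero_le_one (min_le_left _ _)
  have hχs : ∀ v, q v ≤ s → χ v = 0 := fun v hv =>
    max_eq_left ((min_le_right _ _).trans (div_nonpos_of_nonpos_of_nonneg (by linarith) hspos.le))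
  have hχ2 : ∀ v, 2 * s ≤ q v → χ v = 1 := fun v hv => by
    have : 1 ≤ (q v - s) / s := by rw [le_div_iff₀ hspos]; linarith
    simp only [χ]; rw [min_eq_left this, max_eq_right zero_le_one]
  let ψ : V → ℝ := fun v => χ v / max (q v) s
  have hψc : Continuous ψ := hχc.div (by fun_prop) (fun v => (lt_max_of_lt_right hspos).ne')
  let D : ι → V → ℂ := fun i v => if i = i1 then (h v).2.1 - y i1 v * conj (y k v)
    else if i = i2 then (h v).2.2 - y i2 v * conj (y k v) else 0
  have hDc : ∀ i, Continuous (D i) := by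
    intro i
    by_cases e1 : i = i1
    · simp only [D, e1, if_true]; exact (hhc.snd.fst).sub (hy i1 k)
    · by_cases e2 : i = i2
      · simp only [D, if_neg e1, if_pos e2]; exact (hhc.snd.snd).sub (hy i2 k)
      · simp only [D, if_neg e1, if_neg e2]; exact continuous_const
  have hDn : ∀ i v, ‖D i v‖ ≤ η := by
    intro i v
    have hv := (hhη v).le
    rw [Prod.norm_def, max_le_iff, Prod.norm_def, max_le_iff] at hv
    by_cases e1 : i = i1
    · simp only [D, e1, if_true]; exact hv.2.1
    · by_cases e2 : i = i2
      · simp only [D, if_neg e1, if_pos e2]; exact hv.2.2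
      · simp only [D, if_neg e1, if_neg e2, norm_zero]; positivity
  let c : ι → V → ℂ := fun i v => (ψ v : ℂ) * D i v
  have hcc : ∀ i, Continuous (c i) := fun i =>
    (Complex.continuous_ofReal.comp hψc).mul (hDc i)
  refine ⟨fun v => b v + χ v • ((h v).1 - b v), fun i v => y i v + c i v * y k v, ?_, ?_, ?_, ?_, ?_⟩
  · exact hb.add (hχc.smul (hhc.fst.sub hb))
  · intro i j
    have : (fun v => (y i v + c i v * y k v) * conj (y j v + c j v * y k v)) = fun v =>
        y i v * conj (y j v) + c i v * (y k v * conj (y j v)) + conj (c j v) * (y i v * conj (y k v))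
        + c i v * conj (c j v) * (y k v * conj (y k v)) := by
      funext v; simp only [map_add, map_mul]; ring
    rw [this]
    have hcj : Continuous fun v => conj (c j v) := Complex.continuous_conj.comp (hcc j)
    exact (((hy i j).add ((hcc i).mul (hy k j))).add (hcj.mul (hy i k))).add
      (((hcc i).mul hcj).mul (hy k k))
  · intro v
    by_contra hcon
    push Not at hcon
    obtain ⟨hb', hy'⟩ := hcon
    rcases lt_or_ge 1 ‖v‖ with hv | hv
    · have hyk := hk v hv.le
      have hq0 : q v = 0 := by simp [hq, hyk]
      rw [hχs v (by rw [hq0]; exact hspos.le), zero_smul, add_zero] at hb'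
      rcases hnv v with h' | ⟨c0, hc0, h'⟩
      · exact h' hb'
      · rcases Finset.mem_insert.1 hc0 with rfl | hc0
        · exact h' hyk
        · have := hy' c0 hc0
          simp [hyk] at this
          exact h' this
    rcases lt_or_ge (q v) (2 * s) with hq2 | hq2
    · have hNv := hδN v (by simpa using hv)
      have hbn : ‖b v‖ ≤ η := by
        have : b v = - (χ v • ((h v).1 - b v)) := eq_neg_of_add_eq_zero_left hb'
        rw [this, norm_neg, norm_smul, Real.norm_eq_abs, abs_of_nonneg (hχ0 v)]
        have h3 := (norm_fst_le (h v - (b v, y i1 v * conj (y k v), y i2 v * conj (y k v)))).trans (hhη v).le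
        have h4 : ‖(h v).1 - b v‖ ≤ η := h3
        nlinarith [hχ0 v, hχ1 v, norm_nonneg ((h v).1 - b v)]
      have hyn : ∀ i ∈ C', ‖y i v‖ ^ 2 ≤ η ^ 2 / s := by
        intro i hi
        have h3 : y i v = - (c i v * y k v) := eq_neg_of_add_eq_zero_left (hy' i hi)
        rw [h3, norm_neg, norm_mul, mul_pow]
        change ‖c i v‖ ^ 2 * q v ≤ _
        rcases le_or_gt (q v) s with hqs | hqs
        · have : c i v = 0 := by simp [c, ψ, hχs v hqs]
          rw [this]; simp; positivity
        · have hqp : 0 < q v := hspos.trans hqs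
          have h5 : ‖c i v‖ ≤ η / q v := by
            simp only [c, ψ, norm_mul, Complex.norm_real, Real.norm_eq_abs]
            rw [max_eq_left hqs.le, abs_of_nonneg (div_nonneg (hχ0 v) hqp.le), div_mul_eq_mul_div]
            gcongr
            nlinarith [hχ0 v, hχ1 v, norm_nonneg (D i v), hDn i v]
          calc ‖c i v‖ ^ 2 * q v ≤ (η / q v) ^ 2 * q v := by gcongr
            _ = η ^ 2 / q v := by field_simp
            _ ≤ η ^ 2 / s := by gcongr
      have hyz : ∀ i ∈ C', i ≠ i1 → i ≠ i2 → ‖y i v‖ ^ 2 = 0 := by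
        intro i hi e1 e2
        have h3 : y i v = - (c i v * y k v) := eq_neg_of_add_eq_zero_left (hy' i hi)
        have : c i v = 0 := by simp [c, D, e1, e2]
        rw [h3, this]; simp
      have hsum : ∑ c ∈ C', ‖y c v‖ ^ 2 ≤ 2 * (η ^ 2 / s) := by
        rw [← Finset.sum_subset (s₁ := {i1, i2})]
        · rw [Finset.sum_pair h12]
          have := hyn i1 h1
          have := hyn i2 h2
          linarith
        · intro i hi
          rcases Finset.mem_insert.1 hi with rfl | hi
          · exact h1
          · rw [Finset.mem_singleton.1 hi]; exact h2
        · intro i hi hi'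
          simp only [Finset.mem_insert, Finset.mem_singleton, not_or] at hi'
          exact hyz i hi hi'.1 hi'.2
      have : η ^ 2 / s = δ / 16 := by rw [hη, hs]; field_simp; norm_num
      simp only [N] at hNv
      linarith
    · have hχv := hχ2 v hq2
      have hqp : 0 < q v := by linarith
      rw [hχv, one_smul, add_sub_cancel] at hb'
      have key : ∀ i ∈ C', y i v * conj (y k v) + D i v = 0 := by
        intro i hi
        have h3 : y i v + c i v * y k v = 0 := hy' i hi
        have h4 : ψ v = 1 / q v := by
          simp only [ψ]; rw [hχv, max_eq_left (by linarith)]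
        have h5 : y k v * conj (y k v) = (q v : ℂ) := by
          rw [Complex.mul_conj, hq]; simp [Complex.normSq_eq_norm_sq]
        have h6 : (q v : ℂ) ≠ 0 := by exact_mod_cast hqp.ne'
        have h7 : (y i v + c i v * y k v) * conj (y k v) = 0 := by rw [h3, zero_mul]
        rw [add_mul, mul_assoc, h5] at h7
        simp only [c, h4] at h7
        push_cast at h7
        field_simp at h7
        exact h7
      have k1 := key i1 h1
      have k2 := key i2 h2
      simp only [D, if_true] at k1
      simp only [D, if_neg h12.symm, if_true] at k2
      rw [add_sub_cancel] at k1 k2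
      exact hh0 v (Prod.ext hb' (Prod.ext k1 k2))
  · intro v hv
    have hyk := hk v hv
    have hq0 : q v = 0 := by simp [hq, hyk]
    refine ⟨?_, fun i => ?_⟩
    · simp only [hχs v (by rw [hq0]; exact hspos.le), zero_smul, add_zero]
    · simp [hyk]
  · intro i e1 e2
    funext v
    simp [c, D, e1, e2]

open ComplexConjugate in
theorem elim_all {ι : Type*} [DecidableEq ι] {V B : Type*} [NormedAddCommGroup V] [NormedSpace ℝ V]
    [FiniteDimensional ℝ V] [NormedAddCommGroup B] [NormedSpace ℝ B] [FiniteDimensional ℝ B]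
    (hdim : Module.finrank ℝ V < Module.finrank ℝ B + 4)
    (i1 i2 : ι) (h12 : i1 ≠ i2) (E : Finset ι) :
    ∀ (b : V → B) (y : ι → V → ℂ) (hb : Continuous b)
    (hy : ∀ i j, Continuous fun v => y i v * conj (y j v)) 
    (hnv : ∀ v, b v ≠ 0 ∨ y i1 v ≠ 0 ∨ y i2 v ≠ 0 ∨ ∃ c ∈ E, y c v ≠ 0)
    (hk : ∀ v, 1 ≤ ‖v‖ → ∀ c ∈ E, c ≠ i1 → c ≠ i2 → y c v = 0), 
    ∃ (b' : V → B) (y' : ι → V → ℂ), Continuous b' ∧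
      (∀ i j, Continuous fun v => y' i v * conj (y' j v)) ∧
      (∀ v, b' v ≠ 0 ∨ y' i1 v ≠ 0 ∨ y' i2 v ≠ 0) ∧
      (∀ v, 1 ≤ ‖v‖ → b' v = b v ∧ ∀ i, y' i v = y i v) := by
  induction E using Finset.induction_on with
  | empty =>
    intro b y hb hy hnv hk
    refine ⟨b, y, hb, hy, fun v => ?_, fun v _ => ⟨rfl, fun _ => rfl⟩⟩
    have := hnv v
    simp at this
    simpa using this
  | insert k E hkE ih =>
    intro b y hb hy hnv hk
    by_cases e : k = i1 ∨ k = i2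
    · refine ih b y hb hy (fun v => ?_) (fun v hv c hc => hk v hv c (Finset.mem_insert_of_mem hc))
      rcases hnv v with h | h | h | ⟨c, hc, h⟩
      · exact Or.inl h
      · exact Or.inr (Or.inl h)
      · exact Or.inr (Or.inr (Or.inl h))
      · rcases Finset.mem_insert.1 hc with rfl | hc
        · rcases e with rfl | rfl
          · exact Or.inr (Or.inl h)
          · exact Or.inr (Or.inr (Or.inl h))
        · exact Or.inr (Or.inr (Or.inr ⟨c, hc, h⟩))
    · push Not at e
      obtain ⟨b1, y1, hb1, hy1, hn1, hv1, he1⟩ := elim_one hdim b y hb hy (insert i1 (insert i2 E)) i1 i2 k h12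
        (by simp) (by simp) (by simp [e.1, e.2, hkE]) (fun v => by
          rcases hnv v with h | h | h | ⟨c, hc, h⟩
          · exact Or.inl h
          · exact Or.inr ⟨i1, by simp, h⟩
          · exact Or.inr ⟨i2, by simp, h⟩
          · refine Or.inr ⟨c, ?_, h⟩
            rcases Finset.mem_insert.1 hc with rfl | hc
            · simp
            · simp [hc]) (fun v hv => hk v hv k (by simp) e.1 e.2)
      obtain ⟨b2, y2, hb2, hy2, hn2, hv2⟩ := ih b1 y1 hb1 hy1 (fun v => by
          rcases hn1 v with h | ⟨c, hc, h⟩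
          · exact Or.inl h
          · simp only [Finset.mem_insert] at hc
            rcases hc with rfl | rfl | hc
            · exact Or.inr (Or.inl h)
            · exact Or.inr (Or.inr (Or.inl h))
            · exact Or.inr (Or.inr (Or.inr ⟨c, hc, h⟩)))
        (fun v hv c hc e1 e2 => by
          rw [he1 c e1 e2]; exact hk v hv c (Finset.mem_insert_of_mem hc) e1 e2)
      refine ⟨b2, y2, hb2, hy2, hn2, fun v hv => ⟨?_, fun i => ?_⟩⟩
      · rw [(hv2 v hv).1, (hv1 v hv).1]
      · rw [(hv2 v hv).2 i, (hv1 v hv).2 i]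
end PartD

section PartE
def ConeModel {n r : ℕ} (z : Fin r → Fin n → ℤ) (M : ℕ)
    (Φ : (Fin n → ℂ) → EuclideanSpace ℝ (Fin M)) : Prop :=
  Topology.IsQuotientMap Φ ∧ Φ 0 = 0 ∧ (∀ x, ‖x‖ ≤ ‖Φ x‖) ∧
    ∀ x y, Φ x = Φ y ↔ ∃ t : Fin r → Circle, ∀ j, (weightProd z t j : ℂ) * x j = y j

theorem exists_coneModel0 {n r : ℕ} (z : Fin r → Fin n → ℤ) (m : ℕ)
    (φ : OrbitSpace z ≃ₜ Metric.sphere (0 : EuclideanSpace ℝ (Fin (m + 1))) 1) :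
    ∃ Φ : EuclideanSpace ℂ (Fin n) → EuclideanSpace ℝ (Fin (m + 1)), Continuous Φ ∧
      (∀ x, ‖Φ x‖ = ‖x‖) ∧ Function.Surjective Φ ∧
      ∀ x y, Φ x = Φ y ↔ ∃ t : Fin r → Circle, ∀ j, (weightProd z t j : ℂ) * x j = y j := by
  classical
  have hσ : ∀ x : EuclideanSpace ℂ (Fin n), x ≠ 0 → (((‖x‖⁻¹ : ℝ) : ℂ) • x) ∈ Metric.sphere (0 : EuclideanSpace ℂ (Fin n)) 1 := by
    intro x hx
    have := norm_pos_iff.2 hx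
    rw [mem_sphere_zero_iff_norm, norm_smul, Complex.norm_real, norm_inv, norm_norm, inv_mul_cancel₀ this.ne']
  let σ : {x : EuclideanSpace ℂ (Fin n) // x ≠ 0} → Sph n := fun x => ⟨_, hσ x.1 x.2⟩
  have hσc : Continuous σ := by
    refine Continuous.subtype_mk ?_ _
    have hi : Continuous fun x : {x : EuclideanSpace ℂ (Fin n) // x ≠ 0} => (‖x.1‖⁻¹ : ℝ) :=
      Continuous.inv₀ (continuous_subtype_val.norm) (fun x => norm_ne_zero_iff.2 x.2)
    exact (Complex.continuous_ofReal.comp hi).smul continuous_subtype_val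
  let F : {x : EuclideanSpace ℂ (Fin n) // x ≠ 0} → EuclideanSpace ℝ (Fin (m + 1)) :=
    fun x => ‖x.1‖ • ((φ (Quotient.mk (orbitSetoid z) (σ x))) : EuclideanSpace ℝ (Fin (m + 1)))
  have hFc : Continuous F := by
    refine (continuous_subtype_val.norm).smul ?_
    exact continuous_subtype_val.comp (φ.continuous.comp (continuous_quotient_mk'.comp hσc))
  let Φ : EuclideanSpace ℂ (Fin n) → EuclideanSpace ℝ (Fin (m + 1)) :=
    fun x => if h : x = 0 then 0 else F ⟨x, h⟩
  have hΦ0 : Φ 0 = 0 := by simp [Φ]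
  have hΦF : ∀ x (h : x ≠ 0), Φ x = F ⟨x, h⟩ := fun x h => by simp [Φ, h]
  have hn1 : ∀ p : Metric.sphere (0 : EuclideanSpace ℝ (Fin (m + 1))) 1, ‖(p : EuclideanSpace ℝ (Fin (m + 1)))‖ = 1 :=
    fun p => mem_sphere_zero_iff_norm.1 p.2
  have hnorm : ∀ x, ‖Φ x‖ = ‖x‖ := by
    intro x
    by_cases h : x = 0
    · rw [h, hΦ0, norm_zero, norm_zero]
    · rw [hΦF x h]; simp only [F]; rw [norm_smul, hn1, norm_norm, mul_one]
  refine ⟨Φ, ?_, hnorm, ?_, ?_⟩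
  · rw [continuous_iff_continuousAt]
    intro x
    by_cases h : x = 0
    · subst h
      rw [ContinuousAt, hΦ0, tendsto_zero_iff_norm_tendsto_zero]
      simp_rw [hnorm]
      simpa using (continuous_norm (E := EuclideanSpace ℂ (Fin n))).tendsto 0
    · have hopen : IsOpen {x : EuclideanSpace ℂ (Fin n) | x ≠ 0} := isOpen_ne
      refine ContinuousOn.continuousAt (s := {x | x ≠ 0}) ?_ (hopen.mem_nhds h)
      rw [continuousOn_iff_continuous_domRestrict]
      have he : Set.domRestrict {x : EuclideanSpace ℂ (Fin n) | x ≠ 0} Φ = F := by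
        funext x
        exact hΦF x.1 x.2
      rw [he]
      exact hFc
  · intro v
    by_cases hv : v = 0
    · exact ⟨0, by rw [hΦ0, hv]⟩
    have hvp := norm_pos_iff.2 hv
    obtain ⟨x, hx⟩ := Quotient.exists_rep (φ.symm ⟨‖v‖⁻¹ • v, by
      rw [mem_sphere_zero_iff_norm, norm_smul, norm_inv, norm_norm, inv_mul_cancel₀ hvp.ne']⟩)
    have hx1 : ‖(x : EuclideanSpace ℂ (Fin n))‖ = 1 := mem_sphere_zero_iff_norm.1 x.2
    have hnx : ‖((‖v‖ : ℂ) • (x : EuclideanSpace ℂ (Fin n)))‖ = ‖v‖ := by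
      rw [norm_smul, hx1, Complex.norm_real, norm_norm, mul_one]
    have hne : ((‖v‖ : ℂ) • (x : EuclideanSpace ℂ (Fin n))) ≠ 0 := by
      rw [← norm_ne_zero_iff, hnx]; exact hvp.ne'
    refine ⟨(‖v‖ : ℂ) • (x : EuclideanSpace ℂ (Fin n)), ?_⟩
    rw [hΦF _ hne]
    simp only [F]
    have hs : σ ⟨_, hne⟩ = x := by
      apply Subtype.ext
      simp only [σ]
      rw [hnx, smul_smul, ← Complex.ofReal_mul, inv_mul_cancel₀ hvp.ne', Complex.ofReal_one, one_smul]
    rw [hs, hx, φ.apply_symm_apply, hnx]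
    simp only
    rw [smul_smul, mul_inv_cancel₀ hvp.ne', one_smul]
  · intro x y
    constructor
    · intro h
      have hxy : ‖x‖ = ‖y‖ := by rw [← hnorm, ← hnorm, h]
      by_cases hx : x = 0
      · have hy : y = 0 := by rw [← norm_eq_zero, ← hxy, hx, norm_zero]
        exact ⟨1, fun j => by simp [hx, hy]⟩
      · have hxp := norm_pos_iff.2 hx
        have hy : y ≠ 0 := by rw [← norm_ne_zero_iff, ← hxy]; exact hxp.ne'
        rw [hΦF x hx, hΦF y hy] at h
        simp only [F] at h
        rw [← hxy] at h
        have h2 := smul_right_injective _ hxp.ne' h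
        have h3 := Quotient.exact (φ.injective (Subtype.ext h2))
        obtain ⟨t, ht⟩ := h3
        refine ⟨t, fun j => ?_⟩
        have h4 := ht j
        simp only [σ, PiLp.smul_apply, smul_eq_mul, ← hxy] at h4
        have h5 : (((‖x‖⁻¹ : ℝ) : ℂ)) ≠ 0 := by
          exact_mod_cast (inv_pos.2 hxp).ne'
        apply mul_left_cancel₀ h5
        rw [← h4]; ring
    · rintro ⟨t, ht⟩
      have hxy : ‖x‖ = ‖y‖ := by
        rw [EuclideanSpace.norm_eq, EuclideanSpace.norm_eq]
        congr 1
        refine Finset.sum_congr rfl fun j _ => ?_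
        rw [← ht j, norm_mul, Circle.norm_coe, one_mul]
      by_cases hx : x = 0
      · have hy : y = 0 := by rw [← norm_eq_zero, ← hxy, hx, norm_zero]
        rw [hx, hy]
      · have hxp := norm_pos_iff.2 hx
        have hy : y ≠ 0 := by rw [← norm_ne_zero_iff, ← hxy]; exact hxp.ne'
        rw [hΦF x hx, hΦF y hy]
        simp only [F]
        rw [← hxy]
        have : Quotient.mk (orbitSetoid z) (σ ⟨x, hx⟩) = Quotient.mk (orbitSetoid z) (σ ⟨y, hy⟩) := by
          apply Quotient.sound
          refine ⟨t, fun j => ?_⟩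
          simp only [σ, PiLp.smul_apply, smul_eq_mul, ← hxy, ← ht j]
          ring
        rw [this]

theorem exists_coneModel {n r : ℕ} (z : Fin r → Fin n → ℤ) (m : ℕ)
    (φ : OrbitSpace z ≃ₜ Metric.sphere (0 : EuclideanSpace ℝ (Fin (m + 1))) 1) :
    ∃ Φ, ConeModel z (m + 1) Φ := by
  obtain ⟨Φ, h1, h2, h3, h4⟩ := exists_coneModel0 z m φ
  have hle : ∀ x : EuclideanSpace ℂ (Fin n), ‖WithLp.ofLp x‖ ≤ ‖x‖ := by
    intro x
    rw [pi_norm_le_iff_of_nonneg (norm_nonneg _)]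
    intro i
    exact PiLp.norm_apply_le x i
  have hcl : IsClosedMap Φ := by
    apply IsProperMap.isClosedMap
    rw [isProperMap_iff_tendsto_cocompact]
    refine ⟨h1, ?_⟩
    apply tendsto_cocompact_of_tendsto_dist_comp_atTop 0
    simp_rw [dist_zero_right, h2]
    exact tendsto_norm_cocompact_atTop
  have hq : Topology.IsQuotientMap Φ := hcl.isQuotientMap h1 h3
  refine ⟨fun x => Φ (WithLp.toLp 2 x), ?_, ?_, ?_, ?_⟩
  · have he : Topology.IsQuotientMap (WithLp.toLp 2 : (Fin n → ℂ) → EuclideanSpace ℂ (Fin n)) :=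
      (EuclideanSpace.equiv (Fin n) ℂ).symm.toHomeomorph.isQuotientMap
    exact hq.comp he
  · rw [← norm_eq_zero, h2]; simp
  · intro x
    rw [h2]
    exact hle (WithLp.toLp 2 x)
  · intro x y
    exact h4 _ _
end PartE

section PartF
theorem exists_phase (u : ℂ) : ∃ ω : Circle, (ω : ℂ) * u = (‖u‖ : ℂ) := by
  refine ⟨Circle.exp (-u.arg), ?_⟩
  rw [Circle.coe_exp]
  conv_lhs => rw [← Complex.norm_mul_exp_arg_mul_I u]
  rw [mul_left_comm, ← Complex.exp_add]
  simp

theorem circle_root (ω : Circle) (k : ℤ) (hk : k ≠ 0) : ∃ ω' : Circle, ω' ^ k = ω := by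
  obtain ⟨θ, hθ⟩ : ∃ θ, Circle.exp θ = ω := ⟨_, Circle.exp_arg ω⟩
  refine ⟨Circle.exp (θ / k), ?_⟩
  rw [← hθ, ← Circle.exp_zsmul]
  congr 1
  have : (k : ℝ) ≠ 0 := by exact_mod_cast hk
  simp; field_simp

theorem weightProd_mul {n r : ℕ} (z : Fin r → Fin n → ℤ) (t s : Fin r → Circle) (j : Fin n) :
    weightProd z (t * s) j = weightProd z t j * weightProd z s j := by
  simp [weightProd, mul_zpow, Finset.prod_mul_distrib]

theorem weightProd_one_param {n r : ℕ} (z : Fin r → Fin n → ℤ) (l : Fin r → ℤ) (ω : Circle) (j : Fin n) :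
    weightProd z (fun i => ω ^ l i) j = ω ^ (∑ i, l i * z i j) := by
  simp only [weightProd, ← zpow_mul]
  induction (Finset.univ : Finset (Fin r)) using Finset.induction_on with
  | empty => simp
  | insert a s ha ih => rw [Finset.prod_insert ha, Finset.sum_insert ha, zpow_add, ih]

theorem coneModel_descend {n r : ℕ} {z : Fin r → Fin n → ℤ} {M : ℕ}
    {Φ : (Fin n → ℂ) → EuclideanSpace ℝ (Fin M)} (hΦ : ConeModel z M Φ) {W : Type*}
    [TopologicalSpace W] (f : (Fin n → ℂ) → W) (hf : Continuous f)
    (hinv : ∀ (t : Fin r → Circle) x, f (fun j => (weightProd z t j : ℂ) * x j) = f x) :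
    ∃ g : EuclideanSpace ℝ (Fin M) → W, Continuous g ∧ ∀ x, g (Φ x) = f x := by
  have hs := hΦ.1.surjective
  have key : ∀ x y, Φ x = Φ y → f x = f y := by
    intro x y h
    obtain ⟨t, ht⟩ := (hΦ.2.2.2 x y).1 h
    rw [← hinv t x]; congr 1; funext j; exact ht j
  refine ⟨fun v => f (Function.surjInv hs v), ?_, fun x => key _ _ (Function.surjInv_eq hs _)⟩
  rw [hΦ.1.continuous_iff]
  convert hf using 1
  funext x
  exact key _ _ (Function.surjInv_eq hs _)

theorem no_single {n r : ℕ} {z : Fin r → Fin n → ℤ} {m : ℕ}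
    {Φ : (Fin n → ℂ) → EuclideanSpace ℝ (Fin (m + 1))} (hΦ : ConeModel z (m + 1) Φ)
    (l : Fin r → ℤ) (c : Fin n) (hc : ∑ i, l i * z i c ≠ 0)
    (hj : ∀ j, j ≠ c → ∑ i, l i * z i j = 0) : False := by
  classical
  have hΦc := hΦ.1.continuous
  let H : ℝ → (Fin n → ℂ) → (Fin n → ℂ) := fun τ x => Function.update x c ((‖x c‖ + τ : ℝ) : ℂ)
  have hHc : ∀ τ, Continuous (H τ) := by
    intro τ
    refine Continuous.update continuous_id c ?_
    exact Complex.continuous_ofReal.comp ((continuous_apply c).norm.add continuous_const)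
  -- rotation
  have hrot : ∀ ω : Circle, ∃ t : Fin r → Circle, weightProd z t c = ω ∧ ∀ j, j ≠ c → weightProd z t j = 1 := by
    intro ω
    obtain ⟨ω', h⟩ := circle_root ω _ hc
    refine ⟨fun i => ω' ^ l i, ?_, fun j h' => ?_⟩
    · rw [weightProd_one_param, h]
    · rw [weightProd_one_param, hj j h', zpow_zero]
  have hex : ∀ τ : ℝ, ∃ g : EuclideanSpace ℝ (Fin (m + 1)) → EuclideanSpace ℝ (Fin (m + 1)),
      Continuous g ∧ ∀ x, g (Φ x) = Φ (H τ x) := by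
    intro τ
    refine coneModel_descend hΦ (fun x => Φ (H τ x)) (hΦc.comp (hHc τ)) ?_
    intro t x
    symm
    rw [hΦ.2.2.2]
    obtain ⟨s, hs1, hs2⟩ := hrot (weightProd z t c)⁻¹
    refine ⟨t * s, fun j => ?_⟩
    rw [weightProd_mul]
    by_cases h : j = c
    · subst h
      rw [hs1]; simp [H, Circle.norm_coe]
    · rw [hs2 j h]; simp [H, h]
  obtain ⟨η, hη, hess⟩ := essential (V := EuclideanSpace ℝ (Fin (m + 1))) (fun x => x) (fun x => x)
    GoodMap.id continuous_id (by
      intro v hv τ _ _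
      rw [← add_smul]; simpa using hv)
  have huc : UniformContinuousOn Φ (Metric.closedBall 0 3) :=
    (isCompact_closedBall _ _).uniformContinuousOn_of_continuous hΦc.continuousOn
  obtain ⟨δ, hδ, hδ'⟩ := Metric.uniformContinuousOn_iff.1 huc η hη
  set τ := min (δ / 2) 1 with hτ
  have hτp : 0 < τ := by positivity
  obtain ⟨g, hg, hgΦ⟩ := hex τ
  obtain ⟨v, hv⟩ := hess g hg (by
    intro v _ hv2
    obtain ⟨x0, rfl⟩ := hΦ.1.surjective v
    obtain ⟨ω, hω⟩ := exists_phase (x0 c)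
    obtain ⟨s, hs1, hs2⟩ := hrot ω
    let x : Fin n → ℂ := fun j => (weightProd z s j : ℂ) * x0 j
    have hx : Φ x0 = Φ x := (hΦ.2.2.2 _ _).2 ⟨s, fun j => rfl⟩
    rw [hx] at hv2 ⊢
    have hxc : x c = (‖x c‖ : ℂ) := by
      simp only [x]; rw [hs1, hω]; simp
    have hxn : ‖x‖ ≤ 2 := (hΦ.2.2.1 x).trans hv2
    have hd : dist (H τ x) x ≤ τ := by
      rw [dist_pi_le_iff hτp.le]
      intro j
      by_cases h : j = c
      · subst h
        simp only [H, Function.update_self]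
        rw [dist_eq_norm]
        conv_lhs => rw [hxc]
        push_cast
        simp [abs_of_pos hτp]
      · simp [H, h, hτp.le]
    rw [hgΦ, ← dist_eq_norm]
    apply hδ'
    · rw [mem_closedBall_zero_iff]
      have := norm_le_norm_add_norm_sub' (H τ x) x
      rw [← dist_eq_norm] at this
      have : τ ≤ 1 := min_le_right _ _
      linarith
    · rw [mem_closedBall_zero_iff]; linarith
    · have : τ ≤ δ / 2 := min_le_left _ _
      linarith)
  obtain ⟨x, rfl⟩ := hΦ.1.surjective v
  rw [hgΦ] at hv
  have h1 := hΦ.2.2.1 (H τ x)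
  rw [hv, norm_zero] at h1
  have h2 : H τ x = 0 := norm_le_zero_iff.1 h1
  have h3 := congrFun h2 c
  simp only [H, Function.update_self, Pi.zero_apply] at h3
  have h4 : ‖x c‖ + τ = 0 := by exact_mod_cast h3
  have := norm_nonneg (x c)
  linarith
end PartF

section PartG
open ComplexConjugate

noncomputable def cj (g : ℤ) (u : ℂ) : ℂ := if 0 ≤ g then u else conj u

noncomputable def mon (g : ℤ) (u : ℂ) : ℂ := cj g u ^ g.natAbs

theorem cj_continuous (g : ℤ) : Continuous (cj g) := by
  unfold cj
  by_cases h : 0 ≤ g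
  · simp only [h, if_true]; exact continuous_id
  · simp only [h, if_false]; exact Complex.continuous_conj

theorem cj_cj (g : ℤ) (u : ℂ) : cj g (cj g u) = u := by
  unfold cj
  by_cases h : 0 ≤ g <;> simp [h]

theorem norm_cj (g : ℤ) (u : ℂ) : ‖cj g u‖ = ‖u‖ := by
  unfold cj
  by_cases h : 0 ≤ g <;> simp [h]

theorem cj_real (g : ℤ) (u : ℝ) : cj g (u : ℂ) = u := by
  unfold cj
  by_cases h : 0 ≤ g <;> simp [h]

theorem mon_continuous (g : ℤ) : Continuous (mon g) := (cj_continuous g).pow _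

theorem mon_cj (g : ℤ) (u : ℂ) : mon g (cj g u) = u ^ g.natAbs := by
  unfold mon; rw [cj_cj]

theorem mon_real (g : ℤ) (u : ℝ) : mon g (u : ℂ) = ((u ^ g.natAbs : ℝ) : ℂ) := by
  unfold mon; rw [cj_real]; push_cast; rfl

theorem norm_mon (g : ℤ) (u : ℂ) : ‖mon g u‖ = ‖u‖ ^ g.natAbs := by
  unfold mon; rw [norm_pow, norm_cj]

theorem mon_ne_zero (g : ℤ) (u : ℂ) (hu : u ≠ 0) : mon g u ≠ 0 := by
  rw [← norm_ne_zero_iff, norm_mon]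
  exact pow_ne_zero _ (norm_ne_zero_iff.2 hu)

theorem mon_zero (g : ℤ) (hg : g ≠ 0) : mon g 0 = 0 := by
  rw [← norm_eq_zero, norm_mon]; simp [hg]

theorem mon_rot (g : ℤ) (ω : Circle) (u : ℂ) : mon g ((ω : ℂ) * u) = ((ω ^ g : Circle) : ℂ) * mon g u := by
  unfold mon cj
  by_cases h : 0 ≤ g
  · obtain ⟨k, rfl⟩ := Int.eq_ofNat_of_zero_le h
    simp [mul_pow]
  · obtain ⟨k, rfl⟩ : ∃ k : ℕ, g = -k := ⟨g.natAbs, by omega⟩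
    simp only [h, if_false, map_mul, mul_pow]
    simp only [Int.natAbs_neg, Int.natAbs_natCast, zpow_neg, zpow_natCast]
    rw [← Circle.coe_inv_eq_conj, Circle.coe_inv, Circle.coe_inv, Circle.coe_pow, inv_pow]

def mu {n r : ℕ} (z : Fin r → Fin n → ℤ) (l : Fin r → ℤ) (j : Fin n) : ℤ := ∑ i, l i * z i j

structure SetupData {n r : ℕ} (z : Fin r → Fin n → ℤ) where
  l : Fin r → ℤ
  I : Finset (Fin n)
  g : Fin n → ℤ
  f : Fin n → Fin n → ℤ
  w : Fin r → ℤ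
  hI : ∀ i ∈ I, mu z l i = 0
  htrans : ∀ θ : Fin n → Circle, ∃ t, ∀ i ∈ I, weightProd z t i = θ i
  hg : ∀ j, j ∉ I → g j ≠ 0
  hS : ∀ j, j ∉ I → mu z l j = 0 → ∀ a, g j * z a j + ∑ i ∈ I, f j i * z a i = 0
  hC : ∀ j, mu z l j ≠ 0 → ∀ a, g j * z a j + ∑ i ∈ I, f j i * z a i = w a

namespace SetupData
variable {n r : ℕ} {z : Fin r → Fin n → ℤ} (S : SetupData z)

/-- invariant monomials -/
noncomputable def y (j : Fin n) (x : Fin n → ℂ) : ℂ := mon (S.g j) (x j) * ∏ i ∈ S.I, mon (S.f j i) (x i)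

theorem y_continuous (j : Fin n) : Continuous (S.y j) := by
  unfold y
  exact ((mon_continuous _).comp (continuous_apply j)).mul
    (continuous_finsetProd _ fun i _ => (mon_continuous _).comp (continuous_apply i))

theorem weight_comb (t : Fin r → Circle) (j : Fin n) (h : Fin n → ℤ) (k : ℤ) :
    weightProd z t j ^ k * ∏ i ∈ S.I, weightProd z t i ^ h i = ∏ a, t a ^ (k * z a j + ∑ i ∈ S.I, h i * z a i) := by
  unfold weightProd
  simp_rw [zpow_add, Finset.prod_mul_distrib]
  congr 1
  · rw [← Finset.prod_zpow]
    refine Finset.prod_congr rfl fun a _ => ?_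
    rw [← zpow_mul, mul_comm]
  · simp_rw [← Finset.prod_zpow]
    rw [Finset.prod_comm]
    refine Finset.prod_congr rfl fun a _ => ?_
    induction S.I using Finset.induction_on with
    | empty => simp
    | insert b s hb ih => rw [Finset.prod_insert hb, Finset.sum_insert hb, zpow_add, ih, ← zpow_mul, mul_comm (h b)]

theorem y_rot (t : Fin r → Circle) (x : Fin n → ℂ) (j : Fin n) :
    S.y j (fun j => (weightProd z t j : ℂ) * x j) =
      ((∏ a, t a ^ (S.g j * z a j + ∑ i ∈ S.I, S.f j i * z a i) : Circle) : ℂ) * S.y j x := by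
  rw [← S.weight_comb t j (S.f j) (S.g j)]
  unfold y
  simp_rw [mon_rot, Finset.prod_mul_distrib]
  rw [Circle.coe_mul]
  have : ((∏ i ∈ S.I, weightProd z t i ^ S.f j i : Circle) : ℂ) = ∏ i ∈ S.I, ((weightProd z t i ^ S.f j i : Circle) : ℂ) :=
    map_prod Circle.coeHom _ _
  rw [this]
  ring

theorem y_inv (t : Fin r → Circle) (x : Fin n → ℂ) (j : Fin n) (hj : j ∉ S.I) (hm : mu z S.l j = 0) :
    S.y j (fun j => (weightProd z t j : ℂ) * x j) = S.y j x := by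
  rw [y_rot]
  simp [S.hS j hj hm]

theorem yy_inv (t : Fin r → Circle) (x : Fin n → ℂ) (j k : Fin n) (hj : mu z S.l j ≠ 0) (hk : mu z S.l k ≠ 0) :
    S.y j (fun j => (weightProd z t j : ℂ) * x j) * conj (S.y k (fun j => (weightProd z t j : ℂ) * x j)) =
      S.y j x * conj (S.y k x) := by
  rw [y_rot, y_rot]
  simp only [S.hC j hj, S.hC k hk, map_mul]
  rw [← Circle.coe_inv_eq_conj, Circle.coe_inv]
  have := Circle.coe_ne_zero (∏ a, t a ^ S.w a)
  field_simp

abbrev Bs : Type := ({i : Fin n // i ∈ S.I} → ℝ) × ({j : Fin n // j ∉ S.I ∧ mu z S.l j = 0} → ℂ)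

noncomputable def bmap (x : Fin n → ℂ) : S.Bs := (fun i => ‖x i‖ - 1, fun j => S.y j x)

theorem bmap_continuous : Continuous S.bmap := by
  unfold bmap
  refine Continuous.prodMk ?_ ?_
  · exact continuous_pi fun i => ((continuous_apply _).norm.sub continuous_const)
  · exact continuous_pi fun i => S.y_continuous _

theorem bmap_inv (t : Fin r → Circle) (x : Fin n → ℂ) :
    S.bmap (fun j => (weightProd z t j : ℂ) * x j) = S.bmap x := by
  refine Prod.ext ?_ ?_
  · funext i; simp [bmap, Circle.norm_coe]
  · funext j; exact S.y_inv t x j j.2.1 j.2.2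

/-- base lift -/
noncomputable def lift (β : S.Bs) (x' : Fin n → ℂ) (j : Fin n) : ℂ :=
  if h : j ∈ S.I then ((Real.exp (β.1 ⟨j, h⟩) : ℝ) : ℂ)
  else if h' : mu z S.l j = 0 then cj (S.g j) (β.2 ⟨j, h, h'⟩) else x' j

theorem lift_I (β : S.Bs) (x' : Fin n → ℂ) (j) (h : j ∈ S.I) : S.lift β x' j = ((Real.exp (β.1 ⟨j, h⟩) : ℝ) : ℂ) := by
  simp [lift, h]

theorem lift_J (β : S.Bs) (x' : Fin n → ℂ) (j) (h : j ∉ S.I) (h' : mu z S.l j = 0) :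
    S.lift β x' j = cj (S.g j) (β.2 ⟨j, h, h'⟩) := by
  simp [lift, h, h']

theorem notMem (j : Fin n) (h : mu z S.l j ≠ 0) : j ∉ S.I := fun hj => h (S.hI j hj)

theorem lift_C (β : S.Bs) (x' : Fin n → ℂ) (j) (h' : mu z S.l j ≠ 0) :
    S.lift β x' j = x' j := by
  simp [lift, S.notMem j h', h']

noncomputable def rho (j : Fin n) (β : S.Bs) : ℝ :=
  ∏ i ∈ S.I.attach, Real.exp (β.1 i) ^ (S.f j i).natAbs

theorem rho_pos (j : Fin n) (β : S.Bs) : 0 < S.rho j β :=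
  Finset.prod_pos fun i _ => pow_pos (Real.exp_pos _) _

theorem y_lift (β : S.Bs) (x' : Fin n → ℂ) (j : Fin n) :
    S.y j (S.lift β x') = mon (S.g j) (S.lift β x' j) * (S.rho j β : ℂ) := by
  unfold y rho
  congr 1
  rw [← Finset.prod_attach]
  push_cast
  refine Finset.prod_congr rfl fun i _ => ?_
  rw [S.lift_I _ _ _ i.2, mon_real]
  push_cast; rfl

theorem y_lift_J (β : S.Bs) (x' : Fin n → ℂ) (j : Fin n) (h : j ∉ S.I) (h' : mu z S.l j = 0) :
    S.y j (S.lift β x') = (S.rho j β : ℂ) * (β.2 ⟨j, h, h'⟩) ^ (S.g j).natAbs := by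
  rw [y_lift, S.lift_J _ _ _ h h', mon_cj, mul_comm]

theorem y_lift_C (β : S.Bs) (x' : Fin n → ℂ) (j : Fin n) (h' : mu z S.l j ≠ 0) :
    S.y j (S.lift β x') = mon (S.g j) (x' j) * (S.rho j β : ℂ) := by
  rw [y_lift, S.lift_C _ _ _ h']

noncomputable def PB (β : S.Bs) : S.Bs := (fun i => β.1 i, fun j => β.2 j ^ (S.g j).natAbs)

theorem PB_good : GoodMap S.PB := by
  refine GoodMap.prod (P := fun (α : {i : Fin n // i ∈ S.I} → ℝ) i => α i)
    (Q := fun (u : {j : Fin n // j ∉ S.I ∧ mu z S.l j = 0} → ℂ) j => u j ^ (S.g j.1).natAbs) ?_ ?_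
  · exact GoodMap.pi (P := fun _ x => x) fun i => GoodMap.id
  · refine GoodMap.pi (P := fun (j : {j : Fin n // j ∉ S.I ∧ mu z S.l j = 0}) x => x ^ (S.g j.1).natAbs) fun j => GoodMap.pow _ ?_
    exact Int.natAbs_ne_zero.2 (S.hg _ j.2.1)
end SetupData

theorem htpy_real (a b τ : ℝ) (h1 : 0 < b → 0 < a) (h2 : b < 0 → a < 0) (h0 : 0 ≤ τ) (hτ1 : τ ≤ 1)
    (h : (1 - τ) * a + τ * b = 0) : b = 0 := by
  rcases lt_trichotomy b 0 with hb | hb | hb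
  · have := h2 hb
    rcases h0.eq_or_lt with rfl | h0
    · linarith
    · nlinarith
  · exact hb
  · have := h1 hb
    rcases h0.eq_or_lt with rfl | h0
    · linarith
    · nlinarith

theorem htpy_cplx (ρ : ℝ) (a b : ℂ) (τ : ℝ) (hρ : 0 < ρ) (ha : a = (ρ : ℂ) * b) (h0 : 0 ≤ τ) (hτ1 : τ ≤ 1)
    (h : (1 - τ) • a + τ • b = 0) : b = 0 := by
  rw [ha] at h
  have h2 : (((1 - τ) * ρ + τ : ℝ) : ℂ) * b = 0 := by
    rw [← h]; simp only [Complex.real_smul]; push_cast; ring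
  rcases mul_eq_zero.1 h2 with h3 | h3
  · exfalso
    have h4 : (1 - τ) * ρ + τ = 0 := by exact_mod_cast h3
    rcases h0.eq_or_lt with rfl | h0
    · linarith
    · nlinarith
  · exact h3

theorem SetupData.htpy_B {n r : ℕ} {z : Fin r → Fin n → ℤ} (S : SetupData z) (β : S.Bs) (x' : Fin n → ℂ)
    (τ : ℝ) (h0 : 0 ≤ τ) (hτ1 : τ ≤ 1) (h : (1 - τ) • S.bmap (S.lift β x') + τ • S.PB β = 0) : β = 0 := by
  refine Prod.ext ?_ ?_
  · funext i
    have h1 := congrFun (congrArg Prod.fst h) i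
    simp only [bmap, PB, Prod.fst_add, Prod.smul_fst, Pi.add_apply, Pi.smul_apply, Prod.fst_zero, Pi.zero_apply, smul_eq_mul] at h1
    refine htpy_real _ _ τ ?_ ?_ h0 hτ1 h1
    · intro hb
      rw [S.lift_I _ _ _ i.2, Complex.norm_real, Real.norm_eq_abs, abs_of_pos (Real.exp_pos _)]
      have := Real.one_lt_exp_iff.2 hb
      linarith
    · intro hb
      rw [S.lift_I _ _ _ i.2, Complex.norm_real, Real.norm_eq_abs, abs_of_pos (Real.exp_pos _)]
      have := Real.exp_lt_one_iff.2 hb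
      linarith
  · funext j
    have h1 := congrFun (congrArg Prod.snd h) j
    simp only [bmap, PB, Prod.snd_add, Prod.smul_snd, Pi.add_apply, Pi.smul_apply, Prod.snd_zero, Pi.zero_apply] at h1
    have := htpy_cplx _ _ _ τ (S.rho_pos j β) (S.y_lift_J β x' j j.2.1 j.2.2) h0 hτ1 h1
    exact eq_zero_of_pow_eq_zero this
end PartG

section PartH
open ComplexConjugate

namespace SetupData
variable {n r : ℕ} {z : Fin r → Fin n → ℤ} (S : SetupData z)

theorem lift_continuous {V : Type*} [TopologicalSpace V] (β : V → S.Bs) (x' : V → Fin n → ℂ) (hβ : Continuous β) (v : V)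
    (hx' : ∀ j, mu z S.l j ≠ 0 → ContinuousAt (fun v => x' v j) v) :
    ContinuousAt (fun v => S.lift (β v) (x' v)) v := by
  rw [continuousAt_pi]
  intro j
  by_cases h : j ∈ S.I
  · have : (fun v => S.lift (β v) (x' v) j) = fun v => ((Real.exp ((β v).1 ⟨j, h⟩) : ℝ) : ℂ) := by
      funext v; exact S.lift_I _ _ _ h
    rw [this]
    refine Continuous.continuousAt ?_
    exact Complex.continuous_ofReal.comp (Real.continuous_exp.comp ((continuous_apply _).comp (continuous_fst.comp hβ)))
  · by_cases h' : mu z S.l j = 0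
    · have : (fun v => S.lift (β v) (x' v) j) = fun v => cj (S.g j) ((β v).2 ⟨j, h, h'⟩) := by
        funext v; exact S.lift_J _ _ _ h h'
      rw [this]
      refine Continuous.continuousAt ?_
      exact (cj_continuous _).comp ((continuous_apply _).comp (continuous_snd.comp hβ))
    · have : (fun v => S.lift (β v) (x' v) j) = fun v => x' v j := by
        funext v; exact S.lift_C _ _ _ h'
      rw [this]
      exact hx' j h'

theorem stepB {M : ℕ} {Φ : (Fin n → ℂ) → EuclideanSpace ℝ (Fin M)} (hΦ : ConeModel z M Φ)
    (c1 c2 c3 : Fin n) (h12 : c1 ≠ c2) (h13 : c1 ≠ c3) (h23 : c2 ≠ c3)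
    (hc1 : mu z S.l c1 ≠ 0) (hc2 : mu z S.l c2 ≠ 0) (hc3 : mu z S.l c3 ≠ 0) :
    Module.finrank ℝ S.Bs + 5 ≤ M := by
  by_contra hM
  push Not at hM
  let π : (Fin n → ℂ) → S.Bs × ℝ × ℂ × ℂ := fun x =>
    (S.bmap x, ‖x c1‖ - 1, S.y c2 x * conj (S.y c1 x), S.y c3 x * conj (S.y c1 x))
  have hyc := S.y_continuous
  have hyj : ∀ j, Continuous fun x => conj (S.y j x) := fun j => Complex.continuous_conj.comp (hyc j)
  have hπc : Continuous π := S.bmap_continuous.prodMk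
    (((continuous_apply c1).norm.sub continuous_const).prodMk
      (((hyc c2).mul (hyj c1)).prodMk ((hyc c3).mul (hyj c1))))
  obtain ⟨πb, hπb, hπe⟩ := coneModel_descend hΦ π hπc (by
    intro t x
    simp only [π]
    rw [S.bmap_inv, S.yy_inv t x c2 c1 hc2 hc1, S.yy_inv t x c3 c1 hc3 hc1, norm_mul, Circle.norm_coe, one_mul])
  let x' : S.Bs × ℝ × ℂ × ℂ → Fin n → ℂ := fun v j =>
    if j = c1 then ((Real.exp v.2.1 : ℝ) : ℂ) else if j = c2 then cj (S.g c2) v.2.2.1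
      else if j = c3 then cj (S.g c3) v.2.2.2 else 0
  let s : S.Bs × ℝ × ℂ × ℂ → Fin n → ℂ := fun v => S.lift v.1 (x' v)
  have hsc : Continuous s := by
    rw [continuous_iff_continuousAt]
    intro v
    refine S.lift_continuous _ _ continuous_fst v fun j _ => Continuous.continuousAt ?_
    simp only [x']
    have k1 : Continuous fun v : S.Bs × ℝ × ℂ × ℂ => ((Real.exp v.2.1 : ℝ) : ℂ) := by fun_prop
    have k2 : Continuous fun v : S.Bs × ℝ × ℂ × ℂ => cj (S.g c2) v.2.2.1 := (cj_continuous _).comp (by fun_prop)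
    have k3 : Continuous fun v : S.Bs × ℝ × ℂ × ℂ => cj (S.g c3) v.2.2.2 := (cj_continuous _).comp (by fun_prop)
    by_cases e1 : j = c1
    · simpa only [if_pos e1] using k1
    by_cases e2 : j = c2
    · simpa only [if_neg e1, if_pos e2] using k2
    by_cases e3 : j = c3
    · simpa only [if_neg e1, if_neg e2, if_pos e3] using k3
    · simpa only [if_neg e1, if_neg e2, if_neg e3] using continuous_const
  let P : S.Bs × ℝ × ℂ × ℂ → S.Bs × ℝ × ℂ × ℂ := fun v =>
    (S.PB v.1, v.2.1, v.2.2.1 ^ (S.g c2).natAbs, v.2.2.2 ^ (S.g c3).natAbs)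
  have hg2 := Int.natAbs_ne_zero.2 (S.hg c2 (S.notMem c2 hc2))
  have hg3 := Int.natAbs_ne_zero.2 (S.hg c3 (S.notMem c3 hc3))
  have hP : GoodMap P := GoodMap.prod S.PB_good (GoodMap.prod (P := fun x : ℝ => x) GoodMap.id
    (GoodMap.prod (GoodMap.pow _ hg2) (GoodMap.pow _ hg3)))
  obtain ⟨η, hη, hess⟩ := essential P (fun v => πb (Φ (s v))) hP
    (hπb.comp (hΦ.1.continuous.comp hsc)) (by
      intro v hv τ h0 h1 h
      apply hv
      simp only [hπe] at h
      have e1 : v.1 = 0 := S.htpy_B v.1 (x' v) τ h0 h1 (congrArg Prod.fst h)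
      have q2 := congrArg (fun w => w.2.1) h
      have q3 := congrArg (fun w => w.2.2.1) h
      have q4 := congrArg (fun w => w.2.2.2) h
      simp only [π, P, Prod.fst_add, Prod.snd_add, Prod.smul_fst, Prod.smul_snd, smul_eq_mul, Prod.fst_zero, Prod.snd_zero] at q2 q3 q4
      have xc1 : x' v c1 = ((Real.exp v.2.1 : ℝ) : ℂ) := by simp [x']
      have xc2 : x' v c2 = cj (S.g c2) v.2.2.1 := by simp [x', h12.symm]
      have xc3 : x' v c3 = cj (S.g c3) v.2.2.2 := by simp [x', h13.symm, h23.symm]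
      have y1 : S.y c1 (s v) = ((Real.exp v.2.1 ^ (S.g c1).natAbs * S.rho c1 v.1 : ℝ) : ℂ) := by
        simp only [s]; rw [S.y_lift_C _ _ _ hc1, xc1, mon_real]; push_cast; rfl
      have y2 : S.y c2 (s v) = v.2.2.1 ^ (S.g c2).natAbs * (S.rho c2 v.1 : ℂ) := by
        simp only [s]; rw [S.y_lift_C _ _ _ hc2, xc2, mon_cj]
      have y3 : S.y c3 (s v) = v.2.2.2 ^ (S.g c3).natAbs * (S.rho c3 v.1 : ℂ) := by
        simp only [s]; rw [S.y_lift_C _ _ _ hc3, xc3, mon_cj]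
      have hp1 : 0 < Real.exp v.2.1 ^ (S.g c1).natAbs * S.rho c1 v.1 :=
        mul_pos (pow_pos (Real.exp_pos _) _) (S.rho_pos _ _)
      have e2 : v.2.1 = 0 := by
        have hn : ‖s v c1‖ = Real.exp v.2.1 := by
          simp only [s]
          rw [S.lift_C _ _ _ hc1, xc1, Complex.norm_real, Real.norm_eq_abs, abs_of_pos (Real.exp_pos _)]
        rw [hn] at q2
        refine htpy_real _ _ τ ?_ ?_ h0 h1 q2
        · intro hb
          have := Real.one_lt_exp_iff.2 hb
          linarith
        · intro hb
          have := Real.exp_lt_one_iff.2 hb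
          linarith
      have e3 : v.2.2.1 ^ (S.g c2).natAbs = 0 := by
        refine htpy_cplx _ _ _ τ (mul_pos hp1 (S.rho_pos c2 v.1)) ?_ h0 h1 q3
        rw [y1, y2, Complex.conj_ofReal]; push_cast; ring
      have e4 : v.2.2.2 ^ (S.g c3).natAbs = 0 := by
        refine htpy_cplx _ _ _ τ (mul_pos hp1 (S.rho_pos c3 v.1)) ?_ h0 h1 q4
        rw [y1, y3, Complex.conj_ofReal]; push_cast; ring
      exact Prod.ext e1 (Prod.ext e2 (Prod.ext (eq_zero_of_pow_eq_zero e3) (eq_zero_of_pow_eq_zero e4))))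
  obtain ⟨h, hhc, hhη, hh0⟩ := avoid (V := EuclideanSpace ℝ (Fin M)) (W := S.Bs × ℝ × ℂ × ℂ) (by
      have : Module.finrank ℝ (S.Bs × ℝ × ℂ × ℂ) = Module.finrank ℝ S.Bs + 5 := by
        rw [Module.finrank_prod (M := S.Bs), Module.finrank_prod (M := ℝ), Module.finrank_prod (M := ℂ), Complex.finrank_real_complex,
          Module.finrank_self]
      rw [this]; simpa using hM) πb hπb η hη
  obtain ⟨v, hv⟩ := hess (fun v => h (Φ (s v))) (hhc.comp (hΦ.1.continuous.comp hsc)) (fun v _ _ => hhη _)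
  exact hh0 _ hv

end SetupData
end PartH

section PartK
open ComplexConjugate

theorem avoid_rel {V W : Type*} [NormedAddCommGroup V] [NormedSpace ℝ V] [FiniteDimensional ℝ V]
    [NormedAddCommGroup W] [NormedSpace ℝ W] [FiniteDimensional ℝ W]
    (hVW : Module.finrank ℝ V < Module.finrank ℝ W) (f : V → W) (hf : Continuous f)
    (h0 : ∀ v, v ≠ 0 → f v ≠ 0) :
    ∃ F : V → W, Continuous F ∧ (∀ v, F v ≠ 0) ∧ ∀ v, 1 ≤ ‖v‖ → F v = f v := by
  obtain ⟨δ, hδ, hmin⟩ : ∃ δ > 0, ∀ x : V, 1 / 2 ≤ ‖x‖ → ‖x‖ ≤ 1 → δ ≤ ‖f x‖ := by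
    have hcpt : IsCompact {x : V | 1 / 2 ≤ ‖x‖ ∧ ‖x‖ ≤ 1} := by
      refine (isCompact_closedBall (0 : V) 1).of_isClosed_subset ?_ ?_
      · exact (isClosed_le continuous_const continuous_norm).inter
          (isClosed_le continuous_norm continuous_const)
      · intro x hx; simpa using hx.2
    by_cases hemp : {x : V | 1 / 2 ≤ ‖x‖ ∧ ‖x‖ ≤ 1}.Nonempty
    · obtain ⟨x, hx, hm⟩ := hcpt.exists_isMinOn hemp hf.norm.continuousOn
      refine ⟨_, norm_pos_iff.2 (h0 x ?_), fun y h1 h2 => hm ⟨h1, h2⟩⟩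
      rintro rfl
      have := hx.1
      simp at this
      linarith
    · refine ⟨1, one_pos, fun x h1 h2 => (hemp ⟨x, h1, h2⟩).elim⟩
  obtain ⟨h, hhc, hhη, hh0⟩ := avoid hVW f hf δ hδ
  let χ : V → ℝ := fun v => max 0 (min 1 (2 - 2 * ‖v‖))
  have hχc : Continuous χ := by fun_prop
  have hχ0 : ∀ v, 0 ≤ χ v := fun v => le_max_left _ _
  have hχ1 : ∀ v, χ v ≤ 1 := fun v => max_le zero_le_one (min_le_left _ _)
  have hχz : ∀ v, 1 ≤ ‖v‖ → χ v = 0 := fun v hv =>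
    max_eq_left ((min_le_right _ _).trans (by linarith))
  have hχo : ∀ v, ‖v‖ ≤ 1 / 2 → χ v = 1 := fun v hv => by
    simp only [χ]; rw [min_eq_left (by linarith), max_eq_right zero_le_one]
  refine ⟨fun v => f v + χ v • (h v - f v), hf.add (hχc.smul (hhc.sub hf)), ?_, ?_⟩
  · intro v hv
    rcases le_or_gt ‖v‖ (1 / 2) with h1 | h1
    · simp only [hχo v h1, one_smul, add_sub_cancel] at hv
      exact hh0 v hv
    rcases le_or_gt 1 ‖v‖ with h2 | h2
    · simp only [hχz v h2, zero_smul, add_zero] at hv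
      exact h0 v (by rintro rfl; simp at h2; linarith) hv
    · have h3 := hmin v h1.le h2.le
      have h4 : f v = -(χ v • (h v - f v)) := eq_neg_of_add_eq_zero_left hv
      rw [h4, norm_neg, norm_smul, Real.norm_eq_abs, abs_of_nonneg (hχ0 v)] at h3
      nlinarith [hhη v, hχ0 v, hχ1 v, norm_nonneg (h v - f v)]
  · intro v hv
    simp only [hχz v hv, zero_smul, add_zero]

namespace SetupData
variable {n r : ℕ} {z : Fin r → Fin n → ℤ} (S : SetupData z)

noncomputable def phs (u : ℂ) : ℂ := if u = 0 then 1 else u / (‖u‖ : ℂ)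

theorem norm_phs (u : ℂ) : ‖phs u‖ = 1 := by
  unfold phs
  by_cases h : u = 0
  · simp [h]
  · simp [h]

theorem phs_cont (u : ℂ) (h : u ≠ 0) : ContinuousAt phs u := by
  have : phs =ᶠ[nhds u] fun u => u / (‖u‖ : ℂ) := by
    filter_upwards [isOpen_ne.mem_nhds h] with v hv
    have : v ≠ 0 := hv
    simp [phs, this]
  refine ContinuousAt.congr ?_ this.symm
  refine continuousAt_id.div (by fun_prop) ?_
  simpa using h

variable (c1 c2 : Fin n)
abbrev VC : Type := S.Bs × ℝ × ℂ

noncomputable def xC (v : S.VC) (j : Fin n) : ℂ :=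
  if j = c1 then ((‖v.2.2‖ + max v.2.1 0 : ℝ) : ℂ)
  else if j = c2 then cj (S.g c2) (phs v.2.2 * ((‖v.2.2‖ + max (-v.2.1) 0 : ℝ) : ℂ)) else 0

noncomputable def sC (v : S.VC) : Fin n → ℂ := S.lift v.1 (S.xC c1 c2 v)

noncomputable def piC (x : Fin n → ℂ) : S.VC :=
  (S.bmap x, ‖S.y c1 x‖ ^ 2 - ‖S.y c2 x‖ ^ 2, S.y c2 x * conj (S.y c1 x))

noncomputable def PC (v : S.VC) : S.VC := (S.PB v.1, v.2.1, v.2.2 ^ (S.g c2).natAbs)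

theorem PC_good (hc2 : mu z S.l c2 ≠ 0) : GoodMap (S.PC c2) :=
  GoodMap.prod S.PB_good (GoodMap.prod (P := fun x : ℝ => x) GoodMap.id (GoodMap.pow _
    (Int.natAbs_ne_zero.2 (S.hg c2 (S.notMem c2 hc2)))))

theorem norm_y_inv (t : Fin r → Circle) (x : Fin n → ℂ) (j : Fin n) :
    ‖S.y j (fun j => (weightProd z t j : ℂ) * x j)‖ = ‖S.y j x‖ := by
  rw [y_rot, norm_mul, Circle.norm_coe, one_mul]

theorem piC_inv (hc1 : mu z S.l c1 ≠ 0) (hc2 : mu z S.l c2 ≠ 0) (t : Fin r → Circle) (x : Fin n → ℂ) :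
    S.piC c1 c2 (fun j => (weightProd z t j : ℂ) * x j) = S.piC c1 c2 x := by
  simp only [piC]
  rw [S.bmap_inv, S.norm_y_inv, S.norm_y_inv, S.yy_inv t x c2 c1 hc2 hc1]

theorem piC_continuous : Continuous (S.piC c1 c2) := by
  have hyc := S.y_continuous
  exact S.bmap_continuous.prodMk ((((hyc c1).norm.pow 2).sub ((hyc c2).norm.pow 2)).prodMk
      ((hyc c2).mul (Complex.continuous_conj.comp (hyc c1))))

theorem htpy_C (h12 : c1 ≠ c2) (hc1 : mu z S.l c1 ≠ 0) (hc2 : mu z S.l c2 ≠ 0) (v : S.VC) (hv : v ≠ 0)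
    (τ : ℝ) (h0 : 0 ≤ τ) (h1 : τ ≤ 1) :
    (1 - τ) • S.piC c1 c2 (S.sC c1 c2 v) + τ • S.PC c2 v ≠ 0 := by
  intro h
  apply hv
  have e1 : v.1 = 0 := S.htpy_B v.1 _ τ h0 h1 (congrArg Prod.fst h)
  have q2 := congrArg (fun w => w.2.1) h
  have q3 := congrArg (fun w => w.2.2) h
  simp only [piC, PC, Prod.fst_add, Prod.snd_add, Prod.smul_fst, Prod.smul_snd, smul_eq_mul, Prod.fst_zero, Prod.snd_zero] at q2 q3
  have xc1 : S.xC c1 c2 v c1 = ((‖v.2.2‖ + max v.2.1 0 : ℝ) : ℂ) := by simp [xC]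
  have xc2 : S.xC c1 c2 v c2 = cj (S.g c2) (phs v.2.2 * ((‖v.2.2‖ + max (-v.2.1) 0 : ℝ) : ℂ)) := by simp [xC, h12.symm]
  have y1 : S.y c1 (S.sC c1 c2 v) = (((‖v.2.2‖ + max v.2.1 0) ^ (S.g c1).natAbs * S.rho c1 v.1 : ℝ) : ℂ) := by
    simp only [sC]; rw [S.y_lift_C _ _ _ hc1, xc1, mon_real, Complex.ofReal_mul]
  have y2 : S.y c2 (S.sC c1 c2 v) = phs v.2.2 ^ (S.g c2).natAbs *
      (((‖v.2.2‖ + max (-v.2.1) 0) ^ (S.g c2).natAbs * S.rho c2 v.1 : ℝ) : ℂ) := by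
    simp only [sC]; rw [S.y_lift_C _ _ _ hc2, xc2, mon_cj, mul_pow]; push_cast; ring
  have hr1 := S.rho_pos c1 v.1
  have hr2 := S.rho_pos c2 v.1
  have hg1 := Int.natAbs_ne_zero.2 (S.hg c1 (S.notMem c1 hc1))
  have hg2 := Int.natAbs_ne_zero.2 (S.hg c2 (S.notMem c2 hc2))
  have e3 : v.2.2 = 0 := by
    by_contra hu
    have hup := norm_pos_iff.2 hu
    have hph : phs v.2.2 = v.2.2 / (‖v.2.2‖ : ℂ) := by simp [phs, hu]
    have hp1 : 0 < ‖v.2.2‖ + max v.2.1 0 := add_pos_of_pos_of_nonneg hup (le_max_right _ _)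
    have hp2 : 0 < ‖v.2.2‖ + max (-v.2.1) 0 := add_pos_of_pos_of_nonneg hup (le_max_right _ _)
    have := htpy_cplx (((‖v.2.2‖ + max v.2.1 0) ^ (S.g c1).natAbs * S.rho c1 v.1) *
      ((‖v.2.2‖ + max (-v.2.1) 0) ^ (S.g c2).natAbs * S.rho c2 v.1) / ‖v.2.2‖ ^ (S.g c2).natAbs) _ _ τ
      (by positivity) (by
        rw [y1, y2, Complex.conj_ofReal, hph, div_pow]
        push_cast
        ring) h0 h1 q3
    exact hu (eq_zero_of_pow_eq_zero this)
  have e2 : v.2.1 = 0 := by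
    have hp1 : ‖phs (0 : ℂ)‖ = 1 := norm_phs 0
    rw [y1, y2, norm_mul, norm_pow, e3, norm_phs, Complex.norm_real, Complex.norm_real, norm_zero, one_pow, one_mul,
      zero_add, zero_add, Real.norm_eq_abs, Real.norm_eq_abs, sq_abs, sq_abs] at q2
    refine htpy_real _ _ τ ?_ ?_ h0 h1 q2
    · intro hb
      rw [max_eq_left hb.le, max_eq_right (by linarith), zero_pow hg2]
      have : 0 < (v.2.1 ^ (S.g c1).natAbs * S.rho c1 v.1) ^ 2 := by positivity
      simpa using this
    · intro hb
      rw [max_eq_right hb.le, max_eq_left (by linarith), zero_pow hg1]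
      have hb' : 0 < - v.2.1 := by linarith
      have : 0 < ((-v.2.1) ^ (S.g c2).natAbs * S.rho c2 v.1) ^ 2 := by positivity
      simpa using this
  exact Prod.ext e1 (Prod.ext e2 e3)

theorem sC_continuous {M : ℕ} {Φ : (Fin n → ℂ) → EuclideanSpace ℝ (Fin M)} (hΦ : ConeModel z M Φ)
    (h12 : c1 ≠ c2) (hc1 : mu z S.l c1 ≠ 0) (hc2 : mu z S.l c2 ≠ 0) :
    Continuous fun v => Φ (S.sC c1 c2 v) := by
  have k1 : Continuous fun v : S.VC => ((‖v.2.2‖ + max v.2.1 0 : ℝ) : ℂ) := by fun_prop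
  have k2 : Continuous fun v : S.VC => ((‖v.2.2‖ + max (-v.2.1) 0 : ℝ) : ℂ) := by fun_prop
  have xc1 : ∀ v, S.xC c1 c2 v c1 = ((‖v.2.2‖ + max v.2.1 0 : ℝ) : ℂ) := by simp [xC]
  have xc2 : ∀ v, S.xC c1 c2 v c2 = cj (S.g c2) (phs v.2.2 * ((‖v.2.2‖ + max (-v.2.1) 0 : ℝ) : ℂ)) := by simp [xC, h12.symm]
  have xc3 : ∀ v j, j ≠ c1 → j ≠ c2 → S.xC c1 c2 v j = 0 := by intro v j e1 e2; simp [xC, e1, e2]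
  rw [continuous_iff_continuousAt]
  intro v
  -- the first lift
  have first : ContinuousAt (fun v => S.xC c1 c2 v c2) v → ContinuousAt (fun v => Φ (S.sC c1 c2 v)) v := by
    intro hh
    refine hΦ.1.continuous.continuousAt.comp (S.lift_continuous _ _ continuous_fst v fun j _ => ?_)
    by_cases e1 : j = c1
    · subst e1; simp_rw [xc1]; exact k1.continuousAt
    by_cases e2 : j = c2
    · subst e2; exact hh
    · simp_rw [xc3 _ j e1 e2]; exact continuousAt_const
  by_cases hu : v.2.2 = 0
  · rcases le_total 0 v.2.1 with ht | ht
    · apply first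
      have hz : S.xC c1 c2 v c2 = 0 := by
        rw [xc2, ← norm_eq_zero, norm_cj, norm_mul, norm_phs, hu, max_eq_right (by linarith)]; simp
      rw [ContinuousAt, hz, tendsto_zero_iff_norm_tendsto_zero]
      have : (fun v => ‖S.xC c1 c2 v c2‖) = fun v => ‖((‖v.2.2‖ + max (-v.2.1) 0 : ℝ) : ℂ)‖ := by
        funext v; rw [xc2, norm_cj, norm_mul, norm_phs, one_mul]
      rw [this]
      have h3 := k2.norm.tendsto v
      simpa [hu, max_eq_right (show -v.2.1 ≤ 0 by linarith)] using h3
    · -- the rotated lift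
      have hrot : ∀ v, ∃ t : Fin r → Circle, (∀ j, mu z S.l j = 0 → weightProd z t j = 1) ∧
          (weightProd z t c2 : ℂ) * S.xC c1 c2 v c2 = ((‖v.2.2‖ + max (-v.2.1) 0 : ℝ) : ℂ) := by
        intro v
        obtain ⟨ω, hω⟩ := exists_phase (S.xC c1 c2 v c2)
        obtain ⟨ω', hω'⟩ := circle_root ω _ hc2
        refine ⟨fun i => ω' ^ S.l i, fun j hj => ?_, ?_⟩
        · rw [weightProd_one_param]; unfold mu at hj; rw [hj, zpow_zero]
        · rw [weightProd_one_param]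
          unfold mu at hω'
          rw [hω', hω, xc2, norm_cj, norm_mul, norm_phs, one_mul, Complex.norm_real, Real.norm_eq_abs, abs_of_nonneg]
          positivity
      choose t ht1 ht2 using hrot
      have heq : (fun v => Φ (S.sC c1 c2 v)) = fun v => Φ (S.lift v.1 (fun j => (weightProd z (t v) j : ℂ) * S.xC c1 c2 v j)) := by
        funext v
        rw [hΦ.2.2.2]
        refine ⟨t v, fun j => ?_⟩
        simp only [sC]
        by_cases h : mu z S.l j = 0
        · rw [ht1 v j h]
          by_cases h' : j ∈ S.I
          · rw [S.lift_I _ _ _ h', S.lift_I _ _ _ h']; simp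
          · rw [S.lift_J _ _ _ h' h, S.lift_J _ _ _ h' h]; simp
        · rw [S.lift_C _ _ _ h, S.lift_C _ _ _ h]
      rw [heq]
      refine hΦ.1.continuous.continuousAt.comp (S.lift_continuous _ _ continuous_fst v fun j _ => ?_)
      by_cases e1 : j = c1
      · subst e1
        have hz : (weightProd z (t v) j : ℂ) * S.xC j c2 v j = 0 := by
          rw [xc1, hu, max_eq_right ht]; simp
        rw [ContinuousAt, hz, tendsto_zero_iff_norm_tendsto_zero]
        have : (fun v => ‖(weightProd z (t v) j : ℂ) * S.xC j c2 v j‖) = fun v => ‖((‖v.2.2‖ + max (v.2.1) 0 : ℝ) : ℂ)‖ := by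
          funext v; rw [xc1, norm_mul, Circle.norm_coe, one_mul]
        rw [this]
        have h3 := k1.norm.tendsto v
        simpa [hu, max_eq_right ht] using h3
      by_cases e2 : j = c2
      · subst e2
        simp_rw [ht2]
        exact k2.continuousAt
      · simp_rw [xc3 _ j e1 e2, mul_zero]; exact continuousAt_const
  · apply first
    simp_rw [xc2]
    refine (cj_continuous _).continuousAt.comp (ContinuousAt.mul ?_ k2.continuousAt)
    exact ContinuousAt.comp (f := fun v : S.VC => v.2.2) (phs_cont _ hu) (by fun_prop)

end SetupData
end PartK

section PartL
open ComplexConjugate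

namespace SetupData
variable {n r : ℕ} {z : Fin r → Fin n → ℤ} (S : SetupData z)

noncomputable def e0 (j : Fin n) : ℂ := if j ∈ S.I then 1 else 0

theorem y_e0 (j : Fin n) (hj : j ∉ S.I) : S.y j S.e0 = 0 := by
  unfold y
  rw [e0, if_neg hj, mon_zero _ (S.hg j hj), zero_mul]

theorem bmap_e0 : S.bmap S.e0 = 0 := by
  refine Prod.ext ?_ ?_
  · funext i; simp [bmap, e0]
  · funext j; exact S.y_e0 j j.2.1

theorem eq_e0 {M : ℕ} {Φ : (Fin n → ℂ) → EuclideanSpace ℝ (Fin M)} (hΦ : ConeModel z M Φ)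
    (x : Fin n → ℂ) (hb : S.bmap x = 0) (hy : ∀ c, mu z S.l c ≠ 0 → S.y c x = 0) : Φ x = Φ S.e0 := by
  have hn : ∀ i ∈ S.I, ‖x i‖ = 1 := by
    intro i hi
    have := congrFun (congrArg Prod.fst hb) ⟨i, hi⟩
    simp only [bmap, Prod.fst_zero, Pi.zero_apply] at this
    linarith
  have hyz : ∀ j, j ∉ S.I → x j = 0 := by
    intro j hj
    have h1 : S.y j x = 0 := by
      by_cases h : mu z S.l j = 0
      · exact congrFun (congrArg Prod.snd hb) ⟨j, hj, h⟩
      · exact hy j h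
    by_contra hne
    refine mul_ne_zero (mon_ne_zero _ _ hne) (Finset.prod_ne_zero_iff.2 fun i hi => mon_ne_zero _ _ ?_) h1
    rw [← norm_ne_zero_iff, hn i hi]; exact one_ne_zero
  choose θ hθ using fun i => exists_phase (x i)
  obtain ⟨t, ht⟩ := S.htrans θ
  rw [hΦ.2.2.2]
  refine ⟨t, fun j => ?_⟩
  by_cases h : j ∈ S.I
  · rw [ht j h, hθ, hn j h, e0, if_pos h]; simp
  · rw [hyz j h, mul_zero, e0, if_neg h]

theorem stepC {M : ℕ} {Φ : (Fin n → ℂ) → EuclideanSpace ℝ (Fin M)} (hΦ : ConeModel z M Φ)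
    (c1 c2 : Fin n) (h12 : c1 ≠ c2) (hc1 : mu z S.l c1 ≠ 0) (hc2 : mu z S.l c2 ≠ 0)
    (hM : Module.finrank ℝ S.Bs + 3 < M) : False := by
  classical
  have hdim : Module.finrank ℝ S.VC = Module.finrank ℝ S.Bs + 3 := by
    rw [Module.finrank_prod (M := S.Bs), Module.finrank_prod (M := ℝ), Complex.finrank_real_complex, Module.finrank_self]
  obtain ⟨πb, hπb, hπe⟩ := coneModel_descend hΦ (S.piC c1 c2) (S.piC_continuous c1 c2) (S.piC_inv c1 c2 hc1 hc2)
  have hsc := S.sC_continuous c1 c2 hΦ h12 hc1 hc2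
  obtain ⟨η, hη, hess⟩ := essential (S.PC c2) (fun v => πb (Φ (S.sC c1 c2 v))) (S.PC_good c2 hc2)
    (hπb.comp hsc) (by
      intro v hv τ h0 h1
      simp only [hπe]
      exact S.htpy_C c1 c2 h12 hc1 hc2 v hv τ h0 h1)
  obtain ⟨F, hFc, hF0, hFe⟩ := avoid_rel (V := S.VC) (W := EuclideanSpace ℝ (Fin M)) (by rw [hdim]; simpa using hM)
    (fun v => Φ (S.sC c1 c2 v) - Φ S.e0) (hsc.sub continuous_const) (by
      intro v hv h
      have h1 : Φ (S.sC c1 c2 v) = Φ S.e0 := sub_eq_zero.1 h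
      have h2 : S.piC c1 c2 (S.sC c1 c2 v) = 0 := by
        rw [← hπe, h1, hπe]
        simp only [piC]
        rw [S.bmap_e0, S.y_e0 _ (S.notMem _ hc1), S.y_e0 _ (S.notMem _ hc2)]
        simp
      have h3 := S.htpy_C c1 c2 h12 hc1 hc2 v hv 0 le_rfl zero_le_one
      rw [h2] at h3
      simp at h3)
  obtain ⟨x, hx⟩ : ∃ x : S.VC → Fin n → ℂ, ∀ v, Φ (x v) = F v + Φ S.e0 :=
    ⟨fun v => Function.surjInv hΦ.1.surjective (F v + Φ S.e0), fun v => Function.surjInv_eq _ _⟩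
  have desc : ∀ {W : Type} [TopologicalSpace W] (f : (Fin n → ℂ) → W), Continuous f →
      (∀ (t : Fin r → Circle) x, f (fun j => (weightProd z t j : ℂ) * x j) = f x) →
      Continuous fun v => f (x v) := by
    intro W _ f hf hinv
    obtain ⟨g, hg, hge⟩ := coneModel_descend hΦ f hf hinv
    have : (fun v => f (x v)) = fun v => g (F v + Φ S.e0) := by
      funext v; rw [← hge, hx]
    rw [this]
    exact hg.comp (hFc.add continuous_const)
  have hout : ∀ v, 1 ≤ ‖v‖ → Φ (x v) = Φ (S.sC c1 c2 v) := by
    intro v hv; rw [hx, hFe v hv]; simp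
  obtain ⟨b', y', hb', hy', hn', he'⟩ := elim_all (ι := {c : Fin n // mu z S.l c ≠ 0}) (V := S.VC) (B := S.Bs)
    (by rw [hdim]; omega) ⟨c1, hc1⟩ ⟨c2, hc2⟩ (by simpa using h12) Finset.univ
    (fun v => S.bmap (x v)) (fun c v => S.y c (x v))
    (desc _ S.bmap_continuous S.bmap_inv)
    (fun i j => desc (fun x => S.y i x * conj (S.y j x))
      ((S.y_continuous _).mul (Complex.continuous_conj.comp (S.y_continuous _)))
      (fun t x => S.yy_inv t x i j i.2 j.2))
    (by
      intro v
      by_contra hcon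
      push Not at hcon
      obtain ⟨k1, k2, k3, k4⟩ := hcon
      apply hF0 v
      have := S.eq_e0 hΦ (x v) k1 (fun c hc => k4 ⟨c, hc⟩ (Finset.mem_univ _))
      rw [hx] at this
      simpa using this)
    (by
      intro v hv c _ e1 e2
      have e1' : c.1 ≠ c1 := fun h => e1 (Subtype.ext h)
      have e2' : c.1 ≠ c2 := fun h => e2 (Subtype.ext h)
      obtain ⟨t, ht⟩ := (hΦ.2.2.2 _ _).1 (hout v hv).symm
      have hxv : x v = fun j => (weightProd z t j : ℂ) * S.sC c1 c2 v j := by funext j; exact (ht j).symm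
      rw [← norm_eq_zero, hxv, S.norm_y_inv, sC, S.y_lift_C _ _ _ c.2, xC, if_neg e1', if_neg e2',
        mon_zero _ (S.hg _ (S.notMem _ c.2)), zero_mul, norm_zero])
  have hsq : ∀ i, Continuous fun v => ‖y' i v‖ ^ 2 := by
    intro i
    have : (fun v => ‖y' i v‖ ^ 2) = fun v => ‖y' i v * conj (y' i v)‖ := by
      funext v; rw [norm_mul, RCLike.norm_conj, sq]
    rw [this]
    exact (hy' i i).norm
  obtain ⟨v, hv⟩ := hess (fun v => (b' v, ‖y' ⟨c1, hc1⟩ v‖ ^ 2 - ‖y' ⟨c2, hc2⟩ v‖ ^ 2,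
      y' ⟨c2, hc2⟩ v * conj (y' ⟨c1, hc1⟩ v)))
    (hb'.prodMk (((hsq _).sub (hsq _)).prodMk (hy' _ _))) (by
      intro v hv _
      have h1 := he' v hv
      have : πb (Φ (S.sC c1 c2 v)) = (b' v, ‖y' ⟨c1, hc1⟩ v‖ ^ 2 - ‖y' ⟨c2, hc2⟩ v‖ ^ 2,
          y' ⟨c2, hc2⟩ v * conj (y' ⟨c1, hc1⟩ v)) := by
        rw [← hout v hv, hπe, h1.1, h1.2, h1.2]
        rfl
      rw [this, sub_self, norm_zero]
      exact hη)
  have k1 : b' v = 0 := congrArg Prod.fst hv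
  have k2 : ‖y' ⟨c1, hc1⟩ v‖ ^ 2 - ‖y' ⟨c2, hc2⟩ v‖ ^ 2 = 0 := congrArg (fun w => w.2.1) hv
  have k3 : y' ⟨c2, hc2⟩ v * conj (y' ⟨c1, hc1⟩ v) = 0 := congrArg (fun w => w.2.2) hv
  rcases mul_eq_zero.1 k3 with h | h
  · rw [h] at k2
    have h' : y' ⟨c1, hc1⟩ v = 0 := by simpa using k2
    rcases hn' v with h3 | h3 | h3
    · exact h3 k1
    · exact h3 h'
    · exact h3 h
  · have h' : y' ⟨c1, hc1⟩ v = 0 := by simpa using h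
    rw [h'] at k2
    have h : y' ⟨c2, hc2⟩ v = 0 := by simpa using k2
    rcases hn' v with h3 | h3 | h3
    · exact h3 k1
    · exact h3 h'
    · exact h3 h

theorem no_three {M : ℕ} {Φ : (Fin n → ℂ) → EuclideanSpace ℝ (Fin M)} (hΦ : ConeModel z M Φ)
    (c1 c2 c3 : Fin n) (h12 : c1 ≠ c2) (h13 : c1 ≠ c3) (h23 : c2 ≠ c3)
    (hc1 : mu z S.l c1 ≠ 0) (hc2 : mu z S.l c2 ≠ 0) (hc3 : mu z S.l c3 ≠ 0) : False := by
  have := S.stepB hΦ c1 c2 c3 h12 h13 h23 hc1 hc2 hc3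
  exact S.stepC hΦ c1 c2 h12 hc1 hc2 (by omega)

end SetupData
end PartL

section PartM
theorem clear_denoms {ι : Type*} [Fintype ι] (q : ι → ℚ) :
    ∃ D : ℤ, D ≠ 0 ∧ ∃ l : ι → ℤ, ∀ i, (l i : ℚ) = D * q i := by
  classical
  refine ⟨∏ i, (q i).den, ?_, fun i => (∏ k ∈ Finset.univ.erase i, ((q k).den : ℤ)) * (q i).num, ?_⟩
  · rw [Finset.prod_ne_zero_iff]
    intro i _
    exact_mod_cast (q i).den_nz
  · intro i
    rw [← Finset.mul_prod_erase Finset.univ _ (Finset.mem_univ i)]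
    push_cast
    conv_rhs => rw [mul_assoc, mul_comm ((q i).den : ℚ), mul_assoc, Rat.mul_den_eq_num]

def colQ {n r : ℕ} (z : Fin r → Fin n → ℤ) (j : Fin n) : Fin r → ℚ := fun i => (z i j : ℚ)

theorem dual_int {n r : ℕ} (z : Fin r → Fin n → ℤ) (lam : (Fin r → ℚ) →ₗ[ℚ] ℚ) :
    ∃ D : ℤ, D ≠ 0 ∧ ∃ l : Fin r → ℤ, ∀ j, (mu z l j : ℚ) = D * lam (colQ z j) := by
  obtain ⟨D, hD, l, hl⟩ := clear_denoms (fun i => lam (Pi.single i 1))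
  refine ⟨D, hD, l, fun j => ?_⟩
  rw [LinearMap.pi_apply_eq_sum_univ lam (colQ z j), Finset.mul_sum]
  unfold mu
  push_cast
  refine Finset.sum_congr rfl fun i _ => ?_
  rw [hl i]
  simp only [colQ, smul_eq_mul, Pi.single_apply, eq_comm]
  have : (Pi.single i 1 : Fin r → ℚ) = fun j => if i = j then 1 else 0 := by
    funext j; simp [Pi.single_apply, eq_comm]
  rw [this]; ring

theorem trans_of_indep {n r : ℕ} (z : Fin r → Fin n → ℤ) (I : Finset (Fin n))
    (hI : LinearIndepOn ℚ (colQ z) (I : Set (Fin n))) (θ : Fin n → Circle) :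
    ∃ t, ∀ i ∈ I, weightProd z t i = θ i := by
  classical
  have key : ∀ i0 ∈ I, ∃ t : Fin r → Circle, weightProd z t i0 = θ i0 ∧
      ∀ i ∈ I, i ≠ i0 → weightProd z t i = 1 := by
    intro i0 hi0
    obtain ⟨lam, h1, h2⟩ := Submodule.exists_le_ker_of_notMem
      (linearIndepOn_iff_notMem_span.1 hI i0 hi0)
    obtain ⟨D, hD, l, hl⟩ := dual_int z lam
    have hne : mu z l i0 ≠ 0 := by
      have : (mu z l i0 : ℚ) ≠ 0 := by
        rw [hl]; exact mul_ne_zero (by exact_mod_cast hD) h1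
      exact_mod_cast this
    obtain ⟨ω, hω⟩ := circle_root (θ i0) _ hne
    refine ⟨fun i => ω ^ l i, ?_, ?_⟩
    · rw [weightProd_one_param]; exact hω
    · intro i hi hii
      rw [weightProd_one_param]
      have : mu z l i = 0 := by
        have : (mu z l i : ℚ) = 0 := by
          rw [hl]
          have := h2 (Submodule.subset_span ⟨i, ⟨hi, hii⟩, rfl⟩)
          rw [LinearMap.mem_ker] at this
          rw [this, mul_zero]
        exact_mod_cast this
      unfold mu at this
      rw [this, zpow_zero]
  have ind : ∀ J : Finset (Fin n), J ⊆ I → ∃ t : Fin r → Circle,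
      ∀ i ∈ I, weightProd z t i = if i ∈ J then θ i else 1 := by
    intro J
    induction J using Finset.induction_on with
    | empty => intro _; exact ⟨1, fun i _ => by simp [weightProd]⟩
    | insert a J ha ih =>
      intro hJ
      obtain ⟨t, ht⟩ := ih (fun x hx => hJ (Finset.mem_insert_of_mem hx))
      obtain ⟨s, hs1, hs2⟩ := key a (hJ (Finset.mem_insert_self _ _))
      refine ⟨t * s, fun i hi => ?_⟩
      rw [weightProd_mul, ht i hi]
      by_cases hia : i = a
      · subst hia; simp [ha, hs1]
      · rw [hs2 i hi hia]; simp [hia]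
  obtain ⟨t, ht⟩ := ind I (Finset.Subset.refl _)
  exact ⟨t, fun i hi => by rw [ht i hi]; simp [hi]⟩

theorem mem_span_cols {n r : ℕ} (z : Fin r → Fin n → ℤ) (I : Finset (Fin n)) (x : Fin r → ℚ)
    (hx : x ∈ Submodule.span ℚ (colQ z '' (I : Set (Fin n)))) :
    ∃ a : Fin n → ℚ, x = ∑ i ∈ I, a i • colQ z i := by
  classical
  obtain ⟨c, hc⟩ := (Submodule.mem_span_image_finset_iff_exists_fun ℚ).1 hx
  refine ⟨fun i => if h : i ∈ I then c ⟨i, h⟩ else 0, ?_⟩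
  rw [← hc, ← Finset.sum_coe_sort I]
  refine Finset.sum_congr rfl fun i _ => ?_
  simp [i.2]

theorem exists_setup {n r : ℕ} (z : Fin r → Fin n → ℤ) (lam : (Fin r → ℚ) →ₗ[ℚ] ℚ)
    (c0 : Fin n) (hc0 : lam (colQ z c0) ≠ 0)
    (hmin : ∀ lam' : (Fin r → ℚ) →ₗ[ℚ] ℚ, lam' ≠ 0 →
      (∀ j, lam (colQ z j) = 0 → lam' (colQ z j) = 0) → lam' (colQ z c0) ≠ 0) :
    ∃ S : SetupData z, ∀ j, mu z S.l j ≠ 0 ↔ lam (colQ z j) ≠ 0 := by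
  classical
  obtain ⟨b, hbS, -, hspan, hind⟩ := exists_linearIndepOn_extension
    (v := colQ z) (s := ∅) (t := {j | lam (colQ z j) = 0}) (K := ℚ) (linearIndepOn_empty _ _)
    (Set.empty_subset _)
  set I : Finset (Fin n) := b.toFinset with hIdef
  have hIb : (I : Set (Fin n)) = b := by simp [hIdef]
  rw [← hIb] at hbS hspan hind
  have hperp : ∀ x : Fin r → ℚ, lam x = 0 → x ∈ Submodule.span ℚ (colQ z '' (I : Set (Fin n))) := by
    intro x hx
    by_contra hnot
    obtain ⟨f, hf, hker⟩ := Submodule.exists_le_ker_of_notMem hnot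
    have hfS : ∀ j, lam (colQ z j) = 0 → f (colQ z j) = 0 := fun j hj =>
      LinearMap.mem_ker.1 (hker (hspan ⟨j, hj, rfl⟩))
    refine hmin (f - (f (colQ z c0) / lam (colQ z c0)) • lam) ?_ ?_ ?_
    · intro h0
      apply hf
      have := LinearMap.congr_fun h0 x
      simpa [hx] using this
    · intro j hj
      simp [hj, hfS j hj]
    · simp [hc0]
  obtain ⟨D0, hD0, l, hl⟩ := dual_int z lam
  have hD0' : (D0 : ℚ) ≠ 0 := by exact_mod_cast hD0
  have hmu : ∀ j, mu z l j ≠ 0 ↔ lam (colQ z j) ≠ 0 := by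
    intro j
    have : mu z l j = 0 ↔ lam (colQ z j) = 0 := by
      rw [← Int.cast_eq_zero (α := ℚ), hl]; simp [hD0']
    exact not_congr this
  have hmu0 : ∀ j, mu z l j = 0 ↔ lam (colQ z j) = 0 := fun j => not_iff_not.1 (hmu j)
  let q : Fin n → ℚ := fun j => if lam (colQ z j) = 0 then 1 else 1 / lam (colQ z j)
  have hq : ∀ j, q j ≠ 0 := by
    intro j
    by_cases h : lam (colQ z j) = 0 <;> simp [q, h]
  have hrel : ∀ j, ∃ a : Fin n → ℚ,
      q j • colQ z j - (if lam (colQ z j) = 0 then 0 else q c0 • colQ z c0) = ∑ i ∈ I, a i • colQ z i := by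
    intro j
    apply mem_span_cols
    apply hperp
    by_cases h : lam (colQ z j) = 0
    · simp [h]
    · simp [h, q, hc0]
  choose a ha using hrel
  obtain ⟨D, hD, L, hL⟩ := clear_denoms (fun s : Fin n ⊕ (Fin n × Fin n) =>
    Sum.elim q (fun p => a p.1 p.2) s)
  have hD' : (D : ℚ) ≠ 0 := by exact_mod_cast hD
  have hLq : ∀ j, (L (Sum.inl j) : ℚ) = D * q j := fun j => hL (Sum.inl j)
  have hLa : ∀ j i, (L (Sum.inr (j, i)) : ℚ) = D * a j i := fun j i => hL (Sum.inr (j, i))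
  have hrow : ∀ j k, q j * z k j - (if lam (colQ z j) = 0 then 0 else q c0 * z k c0)
      = ∑ i ∈ I, a j i * z k i := by
    intro j k
    have := congrFun (ha j) k
    by_cases h : lam (colQ z j) = 0 <;> simpa [h, colQ, Finset.sum_apply] using this
  have hsum : ∀ j k, ((∑ i ∈ I, -L (Sum.inr (j, i)) * z k i : ℤ) : ℚ)
      = - D * ∑ i ∈ I, a j i * z k i := by
    intro j k
    push_cast
    rw [Finset.mul_sum]
    refine Finset.sum_congr rfl fun i _ => ?_
    rw [hLa]; ring
  refine ⟨{ l := l, I := I, g := fun j => L (Sum.inl j), f := fun j i => - L (Sum.inr (j, i)),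
            w := fun k => L (Sum.inl c0) * z k c0, hI := ?_, htrans := ?_, hg := ?_, hS := ?_, hC := ?_ }, hmu⟩
  · intro i hi
    exact (hmu0 i).2 (hbS hi)
  · exact trans_of_indep z I hind
  · intro j _ h0
    have := hLq j
    rw [h0] at this
    exact mul_ne_zero hD' (hq j) (by simpa using this.symm)
  · intro j _ hj k
    have h := hrow j k
    rw [if_pos ((hmu0 j).1 hj)] at h
    have : ((L (Sum.inl j) * z k j + ∑ i ∈ I, -L (Sum.inr (j, i)) * z k i : ℤ) : ℚ) = 0 := by
      rw [Int.cast_add, hsum, ← h, Int.cast_mul, hLq]; ring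
    exact_mod_cast this
  · intro j hj k
    have h := hrow j k
    rw [if_neg ((hmu j).1 hj)] at h
    have : ((L (Sum.inl j) * z k j + ∑ i ∈ I, -L (Sum.inr (j, i)) * z k i : ℤ) : ℚ)
        = ((L (Sum.inl c0) * z k c0 : ℤ) : ℚ) := by
      rw [Int.cast_add, hsum, ← h, Int.cast_mul, hLq, Int.cast_mul, hLq]; ring
    exact_mod_cast this
end PartM

section PartN
theorem colQ_span {n r : ℕ} (z : Fin r → Fin n → ℤ)
    (heff : Submodule.span ℤ (Set.range fun j => fun i => z i j) = ⊤) :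
    Submodule.span ℚ (Set.range (colQ z)) = ⊤ := by
  classical
  rw [eq_top_iff]
  intro x _
  rw [pi_eq_sum_univ' x]
  refine Submodule.sum_mem _ fun i _ => Submodule.smul_mem _ _ ?_
  have key : ∀ y : Fin r → ℤ, y ∈ Submodule.span ℤ (Set.range fun j => fun i => z i j) →
      (fun i => (y i : ℚ)) ∈ Submodule.span ℚ (Set.range (colQ z)) := by
    intro y hy
    induction hy using Submodule.span_induction with
    | mem y hy =>
      obtain ⟨j, rfl⟩ := hy
      exact Submodule.subset_span ⟨j, rfl⟩
    | zero => convert Submodule.zero_mem _ using 1; funext i; simp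
    | add y y' _ _ h h' => convert Submodule.add_mem _ h h' using 1; funext i; simp
    | smul c y _ h => convert Submodule.smul_mem _ (c : ℚ) h using 1; funext i; simp
  have := key (fun j => if i = j then 1 else 0) (by rw [heff]; trivial)
  convert this using 1
  funext j
  by_cases h : i = j <;> simp [h]

theorem exists_pair {n r : ℕ} {z : Fin r → Fin n → ℤ} {m : ℕ}
    {Φ : (Fin n → ℂ) → EuclideanSpace ℝ (Fin (m + 1))} (hΦ : ConeModel z (m + 1) Φ)
    (hspan : Submodule.span ℚ (Set.range (colQ z)) = ⊤) (P : Fin n → Prop)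
    (lam0 : (Fin r → ℚ) →ₗ[ℚ] ℚ) (h0 : lam0 ≠ 0) (hP : ∀ j, lam0 (colQ z j) ≠ 0 → P j) :
    ∃ lam : (Fin r → ℚ) →ₗ[ℚ] ℚ, ∃ c1 c2, c1 ≠ c2 ∧ P c1 ∧ P c2 ∧ lam (colQ z c1) ≠ 0 ∧
      lam (colQ z c2) ≠ 0 ∧ ∀ j, j ≠ c1 → j ≠ c2 → lam (colQ z j) = 0 := by
  classical
  let supp : ((Fin r → ℚ) →ₗ[ℚ] ℚ) → Finset (Fin n) :=
    fun lam => Finset.univ.filter fun j => lam (colQ z j) ≠ 0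
  have hsupp : ∀ lam j, j ∈ supp lam ↔ lam (colQ z j) ≠ 0 := by intro lam j; simp [supp]
  let T : Set ((Fin r → ℚ) →ₗ[ℚ] ℚ) := {lam | lam ≠ 0 ∧ ∀ j, lam (colQ z j) ≠ 0 → P j}
  have hT : T.Nonempty := ⟨lam0, h0, hP⟩
  obtain ⟨lam, ⟨hne, hlP⟩, hmin⟩ := Function.argminOn_mem (fun l => (supp l).card) T hT |>.elim
    (fun a b => (⟨_, ⟨a, b⟩, fun l' hl' => Function.argminOn_le (fun l => (supp l).card) T hl'⟩ :
      ∃ lam, lam ∈ T ∧ ∀ l' ∈ T, (supp lam).card ≤ (supp l').card))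
  have hmin' : ∀ c0 ∈ supp lam, ∀ lam' : (Fin r → ℚ) →ₗ[ℚ] ℚ, lam' ≠ 0 →
      (∀ j, lam (colQ z j) = 0 → lam' (colQ z j) = 0) → lam' (colQ z c0) ≠ 0 := by
    intro c0 hc0 lam' hl' hsub hz
    have hss : supp lam' ⊆ supp lam := by
      intro j hj
      rw [hsupp] at hj ⊢
      exact fun h => hj (hsub j h)
    have hlt : supp lam' ⊂ supp lam := by
      refine (Finset.ssubset_iff_of_subset hss).2 ⟨c0, hc0, ?_⟩
      rw [hsupp]; simp [hz]
    have := Finset.card_lt_card hlt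
    have := hmin lam' ⟨hl', fun j hj => hlP j ((hsupp _ _).1 (hss ((hsupp _ _).2 hj)))⟩
    omega
  have hnon : (supp lam).Nonempty := by
    by_contra hemp
    apply hne
    apply LinearMap.ext_on_range (v := colQ z) hspan
    intro j
    by_contra hj
    exact hemp ⟨j, (hsupp _ _).2 hj⟩
  obtain ⟨c1, hc1⟩ := hnon
  have hc1' := (hsupp _ _).1 hc1
  by_cases hs1 : ∃ c2, c2 ≠ c1 ∧ lam (colQ z c2) ≠ 0
  · obtain ⟨c2, h21, hc2⟩ := hs1
    refine ⟨lam, c1, c2, h21.symm, hlP _ hc1', hlP _ hc2, hc1', hc2, ?_⟩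
    intro c3 h31 h32
    by_contra hc3
    obtain ⟨S, hS⟩ := exists_setup z lam c1 hc1' (hmin' c1 hc1)
    exact S.no_three hΦ c1 c2 c3 h21.symm (Ne.symm h31) (Ne.symm h32) ((hS _).2 hc1')
      ((hS _).2 hc2) ((hS _).2 hc3)
  · exfalso
    push Not at hs1
    obtain ⟨D, hD, l, hl⟩ := dual_int z lam
    have hD' : (D : ℚ) ≠ 0 := by exact_mod_cast hD
    have hmu0 : ∀ j, mu z l j = 0 ↔ lam (colQ z j) = 0 := by
      intro j
      rw [← Int.cast_eq_zero (α := ℚ), hl]; simp [hD']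
    exact no_single hΦ l c1 (fun h => hc1' ((hmu0 c1).1 h)) (fun j hj => (hmu0 j).2 (hs1 j hj))

theorem sum_of_circuits_linear {n r : ℕ} (z : Fin r → Fin n → ℤ)
    (hspan : Submodule.span ℚ (Set.range (colQ z)) = ⊤)
    (hpair : ∀ (P : Fin n → Prop)
      (lam0 : (Fin r → ℚ) →ₗ[ℚ] ℚ) (_ : lam0 ≠ 0) (_ : ∀ j, lam0 (colQ z j) ≠ 0 → P j),
      ∃ lam : (Fin r → ℚ) →ₗ[ℚ] ℚ, ∃ c1 c2, c1 ≠ c2 ∧ P c1 ∧ P c2 ∧ lam (colQ z c1) ≠ 0 ∧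
      lam (colQ z c2) ≠ 0 ∧ ∀ j, j ≠ c1 → j ≠ c2 → lam (colQ z j) = 0) :
    IsSumOfCircuits z := by
  classical
  let A : (Fin n → ℚ) →ₗ[ℚ] (Fin r → ℚ) := Fintype.linearCombination ℚ (colQ z)
  have hA : ∀ x, A x = ∑ j, x j • colQ z j := fun x => Fintype.linearCombination_apply ℚ (colQ z) x
  have hAr : LinearMap.range A = ⊤ := by
    rw [Fintype.range_linearCombination, hspan]
  obtain ⟨s, hs⟩ := A.exists_rightInverse_of_surjective hAr
  let K := LinearMap.ker A
  have hann : ∀ f : (Fin n → ℚ) →ₗ[ℚ] ℚ, (∀ x ∈ K, f x = 0) →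
      ∃ lam : (Fin r → ℚ) →ₗ[ℚ] ℚ, ∀ x, f x = lam (A x) := by
    intro f hf
    refine ⟨f ∘ₗ s, fun x => ?_⟩
    have : f (x - s (A x)) = 0 := by
      apply hf
      have h2 : A (s (A x)) = A x := LinearMap.congr_fun hs (A x)
      simp [K, LinearMap.mem_ker, h2]
    rw [map_sub, sub_eq_zero] at this
    exact this
  have hAsingle : ∀ j, A (Pi.single j 1) = colQ z j := by
    intro j
    rw [hA, Finset.sum_eq_single j] <;> simp +contextual
  -- the parallel relation
  let E : Setoid (Fin n) :=
    { r := fun j k => ∃ c : ℚ, c ≠ 0 ∧ ∀ x ∈ K, x j = c * x k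
      iseqv := by
        constructor
        · intro j; exact ⟨1, one_ne_zero, fun x _ => by simp⟩
        · rintro j k ⟨c, hc, h⟩
          exact ⟨c⁻¹, inv_ne_zero hc, fun x hx => by rw [h x hx]; field_simp⟩
        · rintro j k i ⟨c, hc, h⟩ ⟨d, hd, h'⟩
          exact ⟨c * d, mul_ne_zero hc hd, fun x hx => by rw [h x hx, h' x hx]; ring⟩ }
  let Q := Quotient E
  have hE : ∀ j : Fin n, ∃ c : ℚ, c ≠ 0 ∧ ∀ x ∈ K, x j = c * x (Quotient.out (⟦j⟧ : Q)) := by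
    intro j
    exact E.symm (Quotient.mk_out j)
  choose c hc0 hc using hE
  let ρ : Q → Fin n := Quotient.out
  have hρ : ∀ q : Q, (⟦ρ q⟧ : Q) = q := fun q => Quotient.out_eq q
  let res : K →ₗ[ℚ] (Q → ℚ) := (LinearMap.funLeft ℚ ℚ ρ) ∘ₗ K.subtype
  have hres : ∀ x q, res x q = x.1 (ρ q) := fun x q => rfl
  have hinj : Function.Injective res := by
    rw [← LinearMap.ker_eq_bot, LinearMap.ker_eq_bot']
    intro x hx
    ext j
    rw [hc j x.1 x.2]
    have : res x ⟦j⟧ = 0 := by rw [hx]; rfl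
    rw [hres] at this
    change c j * x.1 (ρ ⟦j⟧) = 0
    rw [this, mul_zero]
  have hsurj : LinearMap.range res = ⊤ := by
    by_contra hne
    obtain ⟨y, hy⟩ : ∃ y, y ∉ LinearMap.range res := by
      by_contra h; push Not at h; exact hne (eq_top_iff.2 fun y _ => h y)
    obtain ⟨f, hf, hker⟩ := Submodule.exists_le_ker_of_notMem hy
    obtain ⟨lam, hlam⟩ := hann (f ∘ₗ LinearMap.funLeft ℚ ℚ ρ) (by
      intro x hx
      exact LinearMap.mem_ker.1 (hker ⟨⟨x, hx⟩, rfl⟩))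
    have hl0 : lam ≠ 0 := by
      intro h0
      apply hf
      have h1 := hlam (fun j => y ⟦j⟧)
      rw [h0, LinearMap.zero_apply] at h1
      have h2 : LinearMap.funLeft ℚ ℚ ρ (fun j => y ⟦j⟧) = y := by
        funext q; change y ⟦ρ q⟧ = y q; rw [hρ]
      rw [LinearMap.comp_apply, h2] at h1
      exact h1
    obtain ⟨l2, c1, c2, h12, ⟨q1, hq1⟩, ⟨q2, hq2⟩, hl1, hl2, hrest⟩ :=
      hpair (fun j => ∃ q, ρ q = j) lam hl0 (by
        intro j hj
        by_contra hq
        push Not at hq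
        apply hj
        rw [← hAsingle, ← hlam, LinearMap.comp_apply]
        have : LinearMap.funLeft ℚ ℚ ρ (Pi.single j 1) = 0 := by
          funext q
          change (Pi.single j 1 : Fin n → ℚ) (ρ q) = 0
          rw [Pi.single_eq_of_ne (hq q)]
        rw [this, map_zero])
    have hrel : E c1 c2 := by
      refine ⟨- l2 (colQ z c2) / l2 (colQ z c1), div_ne_zero (neg_ne_zero.2 hl2) hl1, ?_⟩
      intro x hx
      have h1 : l2 (A x) = 0 := by rw [LinearMap.mem_ker.1 hx, map_zero]
      rw [hA, map_sum, Fintype.sum_eq_add c1 c2 h12] at h1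
      · simp only [map_smul, smul_eq_mul] at h1
        field_simp
        linarith
      · rintro j ⟨hj1, hj2⟩
        rw [map_smul, hrest j hj1 hj2, smul_zero]
    apply h12
    have : (⟦c1⟧ : Q) = ⟦c2⟧ := Quotient.sound hrel
    rw [← hq1, ← hq2, hρ, hρ] at this
    rw [← hq1, ← hq2, this]
  have hcard : r = n - Fintype.card Q := by
    have h1 := A.finrank_range_add_finrank_ker
    rw [hAr, finrank_top, Module.finrank_fin_fun, Module.finrank_fin_fun] at h1
    have h2 := (LinearEquiv.ofBijective res ⟨hinj, LinearMap.range_eq_top.1 hsurj⟩).finrank_eq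
    rw [Module.finrank_fintype_fun_eq_card] at h2
    change r + Module.finrank ℚ K = n at h1
    omega
  let e := Fintype.equivFin Q
  refine ⟨Fintype.card Q, fun k => Finset.univ.filter fun j => (⟦j⟧ : Q) = e.symm k, ?_, ?_, ?_, ?_, hcard⟩
  · intro k
    exact ⟨ρ (e.symm k), by simp [hρ]⟩
  · intro k
    constructor
    · intro hli
      obtain ⟨x, hx⟩ := LinearMap.range_eq_top.1 hsurj (Pi.single (e.symm k) 1)
      have hxj : ∀ j, x.1 j = c j * (Pi.single (e.symm k) 1 : Q → ℚ) ⟦j⟧ := by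
        intro j
        rw [hc j x.1 x.2, ← hx, hres]
      have hAx : ∑ j, x.1 j • colQ z j = 0 := by rw [← hA]; exact x.2
      rw [Fintype.linearIndependent_iff] at hli
      have h0 := hli (fun j => x.1 j) (by
        have := Finset.sum_coe_sort (Finset.univ.filter fun j => (⟦j⟧ : Q) = e.symm k)
          (fun j => x.1 j • colQ z j)
        refine Eq.trans this ?_
        rw [← hAx]
        refine Finset.sum_subset (Finset.subset_univ _) fun j _ hj => ?_
        have hj' : (⟦j⟧ : Q) ≠ e.symm k := by simpa using hj
        rw [hxj, Pi.single_eq_of_ne hj', mul_zero, zero_smul])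
        ⟨ρ (e.symm k), by simp [hρ]⟩
      have h1 := hxj (ρ (e.symm k))
      rw [hρ, Pi.single_eq_same, mul_one] at h1
      exact hc0 _ (h1.symm.trans h0)
    · intro C hC
      have hsub := hC.subset
      obtain ⟨j0, hj0, hj0C⟩ := Finset.exists_of_ssubset hC
      rw [Fintype.linearIndependent_iff]
      intro g hg
      let x : Fin n → ℚ := fun j => if h : j ∈ C then g ⟨j, h⟩ else 0
      have hx : x ∈ K := by
        change A x = 0
        rw [hA, ← Finset.sum_subset (Finset.subset_univ C), ← Finset.sum_coe_sort C]
        · rw [← hg]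
          refine Finset.sum_congr rfl fun i _ => ?_
          simp only [x, i.2, dif_pos]; rfl
        · intro j _ hj
          simp [x, hj]
      have hj0' : (⟦j0⟧ : Q) = e.symm k := by simpa using hj0
      have h0 : x (ρ (e.symm k)) = 0 := by
        have h1 := hc j0 x hx
        have h2 : x j0 = 0 := by simp [x, hj0C]
        rw [h2, hj0'] at h1
        exact (mul_eq_zero.1 h1.symm).resolve_left (hc0 j0)
      intro i
      have h1 := hc i x hx
      have h2 : (⟦(i : Fin n)⟧ : Q) = e.symm k := by simpa using hsub i.2
      rw [h2] at h1
      have h3 : x i = g i := by simp [x, i.2]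
      rw [← h3, h1]
      change c i * x (ρ (e.symm k)) = 0
      rw [h0, mul_zero]
  · intro k k' hkk
    rw [Finset.disjoint_left]
    intro j hj hj'
    simp only [Finset.mem_filter, Finset.mem_univ, true_and] at hj hj'
    exact hkk (e.symm.injective (hj.symm.trans hj'))
  · intro j
    exact ⟨e ⟦j⟧, by simp⟩

theorem final (n r : ℕ) 
    (z : Fin r → Fin n → ℤ)
    (heff : Submodule.span ℤ (Set.range fun j => fun i => z i j) = ⊤)
    (m : ℕ)
    (hsph : Nonempty (OrbitSpace z ≃ₜ Metric.sphere (0 : EuclideanSpace ℝ (Fin (m + 1))) 1)) :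
    IsSumOfCircuits z := by
  obtain ⟨φ⟩ := hsph
  obtain ⟨Φ, hΦ⟩ := exists_coneModel z m φ
  have hspan := colQ_span z heff
  exact sum_of_circuits_linear z hspan (fun P lam0 h0 hP => exists_pair hΦ hspan P lam0 h0 hP)
end PartN

/-- If the columns of `z` generate `ℤ^r` (effective action) and the orbit
space `X_z` is homeomorphic to a sphere, then the column matroid of `z` is a direct sum of
circuits. -/
theorem sum_of_circuits_of_orbitSpace_homeomorph_sphere (n r : ℕ) (hn : 1 ≤ n)
    (z : Fin r → Fin n → ℤ)
    (heff : Submodule.span ℤ (Set.range fun j => fun i => z i j) = ⊤)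
    (m : ℕ)
    (hsph : Nonempty (OrbitSpace z ≃ₜ Metric.sphere (0 : EuclideanSpace ℝ (Fin (m + 1))) 1)) :
    IsSumOfCircuits z := by
  exact final n r z heff m hsph
end
end

section
/- Let σ be a permutation of Fin n and ε : Fin n → ℤ with ε j ∈ {1, −1} for every j, and define the weight matrix z' by z' i j = ε j · z i (σ j). Then the orbit spaces X_{z'} and X_z are homeomorphic. -/
open scoped BigOperators

noncomputable section

/-- Identity if `e = 1`, complex conjugation otherwise. -/
def signConj (e : ℤ) (w : ℂ) : ℂ := if e = 1 then w else (starRingEnd ℂ) w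

lemma signConj_continuous (e : ℤ) : Continuous (signConj e) := by
  unfold signConj
  split_ifs
  · exact continuous_id
  · exact Complex.continuous_conj

lemma signConj_invol (e : ℤ) (w : ℂ) : signConj e (signConj e w) = w := by
  unfold signConj
  split_ifs <;> simp

lemma signConj_norm (e : ℤ) (w : ℂ) : ‖signConj e w‖ = ‖w‖ := by
  unfold signConj
  split_ifs <;> simp

lemma signConj_mul (e : ℤ) (he : e = 1 ∨ e = -1) (a : Circle) (w : ℂ) :
    signConj e ((a : ℂ) * w) = ((a ^ e : Circle) : ℂ) * signConj e w := by
  unfold signConj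
  rcases he with rfl | rfl
  · simp
  · have h : ((-1 : ℤ) = 1) = False := by simp
    simp only [h, if_false, map_mul, zpow_neg, zpow_one, Circle.coe_inv_eq_conj]

lemma weightProd_twist {n r : ℕ} (z : Fin r → Fin n → ℤ) (σ : Equiv.Perm (Fin n))
    (ε : Fin n → ℤ) (t : Fin r → Circle) (j : Fin n) :
    weightProd (fun i j => ε j * z i (σ j)) t j = weightProd z t (σ j) ^ ε j := by
  unfold weightProd
  rw [← Finset.prod_zpow]
  exact Finset.prod_congr rfl fun i _ => by
    rw [← zpow_mul, mul_comm]

/-- The homeomorphism of the sphere permuting and conjugating coordinates. -/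
def sphHomeo {n : ℕ} (σ : Equiv.Perm (Fin n)) (ε : Fin n → ℤ) : Sph n ≃ₜ Sph n where
  toFun y := ⟨WithLp.toLp 2 fun j => signConj (ε j) (y.1 (σ j)), by
    have hy := y.2
    rw [mem_sphere_zero_iff_norm, EuclideanSpace.norm_eq] at hy ⊢
    refine Eq.trans ?_ hy
    congr 1
    simp only [signConj_norm]
    exact Equiv.sum_comp σ fun k => ‖y.1 k‖ ^ 2⟩
  invFun x := ⟨WithLp.toLp 2 fun k => signConj (ε (σ.symm k)) (x.1 (σ.symm k)), by
    have hx := x.2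
    rw [mem_sphere_zero_iff_norm, EuclideanSpace.norm_eq] at hx ⊢
    refine Eq.trans ?_ hx
    congr 1
    simp only [signConj_norm]
    exact Equiv.sum_comp σ.symm fun k => ‖x.1 k‖ ^ 2⟩
  left_inv y := by
    ext k
    simp [signConj_invol]
  right_inv x := by
    ext k
    simp [signConj_invol]
  continuous_toFun := by
    refine Continuous.subtype_mk ((PiLp.continuous_toLp 2 _).comp
      (continuous_pi fun j => (signConj_continuous _).comp ?_)) _
    fun_prop
  continuous_invFun := by
    refine Continuous.subtype_mk ((PiLp.continuous_toLp 2 _).comp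
      (continuous_pi fun j => (signConj_continuous _).comp ?_)) _
    fun_prop

lemma sphHomeo_rel {n r : ℕ} (z : Fin r → Fin n → ℤ) (σ : Equiv.Perm (Fin n))
    (ε : Fin n → ℤ) (hε : ∀ j, ε j = 1 ∨ ε j = -1) (x y : Sph n) :
    (orbitSetoid z).r x y ↔
      (orbitSetoid (fun i j => ε j * z i (σ j))).r (sphHomeo σ ε x) (sphHomeo σ ε y) := by
  refine exists_congr fun t => ?_
  rw [← σ.forall_congr_right]
  refine forall_congr' fun j => ?_
  rw [weightProd_twist]
  change _ ↔ _ * signConj (ε j) (x.1 (σ j)) = signConj (ε j) (y.1 (σ j))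
  rw [← signConj_mul _ (hε j)]
  exact (Function.LeftInverse.injective (signConj_invol (ε j))).eq_iff.symm

/-- If `σ` is a permutation of `Fin n` and `ε : Fin n → ℤ` takes values in
`{1, -1}`, then the orbit space of the weight matrix `z' i j = ε j * z i (σ j)` is
homeomorphic to that of `z`. -/
theorem orbitSpace_column_permutation_sign (n r : ℕ) (z : Fin r → Fin n → ℤ)
    (σ : Equiv.Perm (Fin n)) (ε : Fin n → ℤ) (hε : ∀ j, ε j = 1 ∨ ε j = -1) :
    Nonempty (OrbitSpace (fun i j => ε j * z i (σ j)) ≃ₜ OrbitSpace z) := by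
  let e : OrbitSpace z ≃ OrbitSpace (fun i j => ε j * z i (σ j)) :=
    Quotient.congr (sphHomeo σ ε).toEquiv (sphHomeo_rel z σ ε hε)
  refine ⟨(Homeomorph.mk e ?_ ?_).symm⟩
  · exact continuous_quot_lift _ (continuous_quotient_mk'.comp (sphHomeo σ ε).continuous)
  · exact continuous_quot_lift _ (continuous_quotient_mk'.comp (sphHomeo σ ε).symm.continuous)
end
end

section
/- Let c ≥ 1 be an integer and i₀ ∈ Fin r an index such that c divides z i₀ j for every j ∈ Fin n, and let z' be the weight matrix obtained from z by replacing row i₀ with j ↦ (z i₀ j) / c. Then the torus actions on S^{2n−1} determined by z and by z' have exactly the same orbits: for every x ∈ S^{2n−1}, the orbit of x under the z'-action equals the orbit of x under the z-action; in particular X_z and X_{z'} coincide (are canonically homeomorphic). -/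
open scoped BigOperators

noncomputable section

/-- The orbit of a point `x ∈ S^{2n-1}` under the linear torus action with weight matrix `z`. -/
def torusOrbit {n r : ℕ} (z : Fin r → Fin n → ℤ) (x : Sph n) : Set (Sph n) :=
  {y | ∃ t : Fin r → Circle,
    ∀ j, (weightProd z t j : ℂ) * (x : EuclideanSpace ℂ (Fin n)) j
      = (y : EuclideanSpace ℂ (Fin n)) j}

theorem circle_exists_zpow (c : ℤ) (hc : 1 ≤ c) (s : Circle) : ∃ u : Circle, u ^ c = s := by
  have hc' : (c : ℝ) ≠ 0 := by
    have : c ≠ 0 := by omega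
    exact_mod_cast this
  refine ⟨Circle.exp (Complex.arg s / c), ?_⟩
  rw [← Circle.exp_zsmul, zsmul_eq_mul, mul_div_cancel₀ _ hc', Circle.exp_arg]

theorem weightProd_divide_row {n r : ℕ} (z : Fin r → Fin n → ℤ) (c : ℤ)
    (i₀ : Fin r) (hdvd : ∀ j, c ∣ z i₀ j) (t s : Fin r → Circle) (h₀ : s i₀ = t i₀ ^ c)
    (h : ∀ i, i ≠ i₀ → s i = t i) (j : Fin n) :
    weightProd (Function.update z i₀ (fun j => z i₀ j / c)) s j = weightProd z t j := by
  unfold weightProd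
  refine Finset.prod_congr rfl fun i _ => ?_
  by_cases hi : i = i₀
  · subst hi
    rw [Function.update_self, h₀, ← zpow_mul, Int.mul_ediv_cancel' (hdvd j)]
  · rw [Function.update_of_ne hi, h i hi]

/-- If `c ≥ 1` divides every entry of row `i₀` of `z`, and `z'` is
obtained from `z` by dividing row `i₀` by `c`, then the torus actions determined by `z` and
`z'` have exactly the same orbits; in particular the orbit spaces coincide. -/
theorem torusOrbit_divide_row (n r : ℕ) (z : Fin r → Fin n → ℤ) (c : ℤ) (hc : 1 ≤ c)
    (i₀ : Fin r) (hdvd : ∀ j, c ∣ z i₀ j) (x : Sph n) :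
    torusOrbit (Function.update z i₀ (fun j => z i₀ j / c)) x = torusOrbit z x := by
  ext y
  constructor
  · rintro ⟨s, hs⟩
    obtain ⟨u, hu⟩ := circle_exists_zpow c hc (s i₀)
    refine ⟨Function.update s i₀ u, fun j => ?_⟩
    rw [← hs j, weightProd_divide_row z c i₀ hdvd (Function.update s i₀ u) s
      (by rw [Function.update_self, hu])
      (fun i hi => by rw [Function.update_of_ne hi])]
  · rintro ⟨t, ht⟩
    refine ⟨Function.update t i₀ (t i₀ ^ c), fun j => ?_⟩
    rw [← ht j, weightProd_divide_row z c i₀ hdvd t _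
      (by rw [Function.update_self])
      (fun i hi => by rw [Function.update_of_ne hi])]
end
end

section
/- For a point x ∈ S^{2n−1}, the stabilizer subgroup {t ∈ T^r : t • x = x} is infinite if and only if the set of columns {(i ↦ (z i j : ℚ)) | j ∈ Fin n, x j ≠ 0} does not span (Fin r → ℚ), i.e. rk({j : x j ≠ 0}) < r. -/
open scoped BigOperators

noncomputable section

/-- The stabilizer `{t ∈ T^r : t • x = x}` of a point `x ∈ S^{2n-1}` under the linear torus
action with weight matrix `z`. -/
def torusStab {n r : ℕ} (z : Fin r → Fin n → ℤ) (x : Sph n) : Set (Fin r → Circle) :=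
  {t | ∀ j, (weightProd z t j : ℂ) * (x : EuclideanSpace ℂ (Fin n)) j
    = (x : EuclideanSpace ℂ (Fin n)) j}

/-- `colRank z A` is the ℚ-dimension of the span in `Fin r → ℚ` of the columns of `z`
indexed by `A`. -/
def colRank {n r : ℕ} (z : Fin r → Fin n → ℤ) (A : Set (Fin n)) : ℕ :=
  Module.finrank ℚ (Submodule.span ℚ ((fun j => fun i => (z i j : ℚ)) '' A))

theorem stab_aux {n r : ℕ} (z : Fin r → Fin n → ℤ) (x : Sph n) (t : Fin r → Circle) :
    t ∈ torusStab z x ↔ ∀ j, (x : EuclideanSpace ℂ (Fin n)) j ≠ 0 → weightProd z t j = 1 := by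
  unfold torusStab
  simp only [Set.mem_ofPred_eq]
  refine forall_congr' fun j => ?_
  constructor
  · intro h hx
    have := mul_right_cancel₀ hx (h.trans (one_mul _).symm)
    exact Circle.ext (by simpa using this)
  · intro h
    by_cases hx : (x : EuclideanSpace ℂ (Fin n)) j = 0
    · simp [hx]
    · simp [h hx]

theorem roots_aux (N : ℕ) (hN : 0 < N) : {u : Circle | u ^ N = 1}.Finite := by
  refine Set.Finite.of_finite_image (f := fun u : Circle => (u : ℂ)) ?_
    (Circle.coe_injective.injOn)
  refine (Polynomial.nthRootsFinset N (1 : ℂ)).finite_toSet.subset ?_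
  rintro _ ⟨u, hu, rfl⟩
  simp only [Finset.mem_coe, Polynomial.mem_nthRootsFinset hN]
  have := congrArg (fun u : Circle => (u : ℂ)) hu
  simpa using this

theorem span_aux {r : ℕ} (S : Set (Fin r → ℚ)) (G : Set (Fin r → Circle))
    (hS : ∀ v ∈ S, ∃ w : Fin r → ℤ, (∀ i, (w i : ℚ) = v i) ∧ ∀ t ∈ G, ∏ i, t i ^ w i = 1)
    (v : Fin r → ℚ) (hv : v ∈ Submodule.span ℚ S) :
    ∃ N : ℕ, 0 < N ∧ ∃ w : Fin r → ℤ, (∀ i, (w i : ℚ) = N * v i) ∧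
      ∀ t ∈ G, ∏ i, t i ^ w i = 1 := by
  induction hv using Submodule.span_induction with
  | mem v hv =>
    obtain ⟨w, h1, h2⟩ := hS v hv
    exact ⟨1, one_pos, w, by simpa using h1, h2⟩
  | zero => exact ⟨1, one_pos, 0, by simp, by simp⟩
  | add a b _ _ iha ihb =>
    obtain ⟨N, hN, w, h1, h2⟩ := iha
    obtain ⟨M, hM, u, h3, h4⟩ := ihb
    refine ⟨N * M, Nat.mul_pos hN hM, fun i => w i * M + u i * N, fun i => ?_, fun t ht => ?_⟩
    · push_cast
      rw [h1, h3, Pi.add_apply]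
      ring
    · simp only [zpow_add, zpow_mul, Finset.prod_mul_distrib, Finset.prod_zpow]
      simp [h2 t ht, h4 t ht]
  | smul q a _ iha =>
    obtain ⟨N, hN, w, h1, h2⟩ := iha
    refine ⟨N * q.den, Nat.mul_pos hN q.den_pos, fun i => w i * q.num, fun i => ?_,
      fun t ht => ?_⟩
    · push_cast
      rw [h1, Pi.smul_apply, smul_eq_mul]
      have := Rat.mul_den_eq_num q
      rw [← this]
      ring
    · simp only [zpow_mul, Finset.prod_zpow]
      simp [h2 t ht]

theorem exp_zpow_aux (a : ℝ) (k : ℤ) : Circle.exp a ^ k = Circle.exp (a * k) := by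
  have := map_zsmul Circle.expHom k a
  rw [mul_comm, ← zsmul_eq_mul]
  exact this.symm

theorem exp_sum_aux {r : ℕ} (f : Fin r → ℝ) : ∏ i, Circle.exp (f i) = Circle.exp (∑ i, f i) := by
  have := map_sum Circle.expHom f Finset.univ
  exact (congrArg Additive.toMul this).symm

theorem torusStab_infinite_iff (n r : ℕ) (z : Fin r → Fin n → ℤ) (x : Sph n) :
    (torusStab z x).Infinite ↔
      colRank z {j | (x : EuclideanSpace ℂ (Fin n)) j ≠ 0} < r := by
  set A : Set (Fin n) := {j | (x : EuclideanSpace ℂ (Fin n)) j ≠ 0} with hA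
  constructor
  · intro hinf
    by_contra hlt
    apply hinf
    have htop : Submodule.span ℚ ((fun j => fun i => (z i j : ℚ)) '' A) = ⊤ := by
      apply Submodule.eq_top_of_finrank_eq
      apply le_antisymm (Submodule.finrank_le _)
      rw [Module.finrank_fin_fun]
      exact not_lt.mp hlt
    have key : ∀ i : Fin r, ∃ N : ℕ, 0 < N ∧ ∀ t ∈ torusStab z x, t i ^ N = 1 := by
      intro i
      obtain ⟨N, hN, w, h1, h2⟩ := span_aux ((fun j => fun i => (z i j : ℚ)) '' A)
        (torusStab z x) (by
          rintro _ ⟨j, hj, rfl⟩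
          exact ⟨fun i => z i j, fun i => rfl, fun t ht => (stab_aux z x t).1 ht j hj⟩)
        (Pi.single i 1) (by rw [htop]; trivial)
      refine ⟨N, hN, fun t ht => ?_⟩
      have h3 := h2 t ht
      rw [Finset.prod_eq_single i] at h3
      · have h4 : w i = N := by
          have := h1 i
          rw [Pi.single_eq_same, mul_one] at this
          exact_mod_cast this
        rw [h4] at h3
        simpa using h3
      · intro k _ hk
        have := h1 k
        rw [Pi.single_eq_of_ne hk, mul_zero] at this
        have h5 : w k = 0 := by exact_mod_cast this
        simp [h5]
      · simp
    choose N hN h using key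
    refine (Set.Finite.pi' (fun i => roots_aux (N i) (hN i))).subset ?_
    intro t ht i
    exact h i t ht
  · intro hlt
    have hne : Submodule.span ℚ ((fun j => fun i => (z i j : ℚ)) '' A) < ⊤ := by
      rw [lt_top_iff_ne_top]
      intro h
      unfold colRank at hlt
      rw [h, finrank_top, Module.finrank_fin_fun] at hlt
      exact lt_irrefl _ hlt
    obtain ⟨f, hf0, hf⟩ := Submodule.exists_le_ker_of_lt_top _ hne
    set v : Fin r → ℚ := fun i => f (Pi.single i 1) with hv
    have hfv : ∀ u : Fin r → ℚ, f u = ∑ i, u i * v i := by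
      intro u
      rw [LinearMap.pi_apply_eq_sum_univ f u]
      simp only [smul_eq_mul, hv]
      refine Finset.sum_congr rfl fun i _ => ?_
      congr 2
      ext k
      simp [Pi.single_apply, eq_comm]
    obtain ⟨i0, hi0⟩ : ∃ i, v i ≠ 0 := by
      by_contra! hcon
      apply hf0
      refine LinearMap.ext fun u => ?_
      simp [hfv, hcon]
    have hi0' : (v i0 : ℝ) ≠ 0 := by exact_mod_cast hi0
    refine Set.infinite_of_injOn_mapsTo (s := Set.Ioo (0 : ℝ) 1)
      (f := fun s i => Circle.exp (s / v i0 * v i)) ?_ ?_ (Set.Ioo_infinite one_pos)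
    · intro s hs s' hs' hss
      have h1 := congrFun hss i0
      simp only [div_mul_cancel₀ _ hi0'] at h1
      have hpi := Real.pi_gt_three
      have h2 := congrArg (fun u : Circle => Complex.arg u) h1
      rwa [Circle.arg_exp (by linarith [hs.1]) (by linarith [hs.2]),
        Circle.arg_exp (by linarith [hs'.1]) (by linarith [hs'.2])] at h2
    · intro s _
      rw [stab_aux]
      intro j hj
      have h0 : f (fun i => (z i j : ℚ)) = 0 :=
        hf (Submodule.subset_span ⟨j, hj, rfl⟩)
      rw [hfv] at h0
      have h1 : ∑ i, (z i j : ℝ) * (v i : ℝ) = 0 := by exact_mod_cast h0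
      unfold weightProd
      simp only [exp_zpow_aux]
      rw [exp_sum_aux]
      have : ∑ i, s / (v i0 : ℝ) * v i * z i j = s / v i0 * ∑ i, (z i j : ℝ) * (v i : ℝ) := by
        rw [Finset.mul_sum]
        exact Finset.sum_congr rfl fun i _ => by ring
      rw [this, h1, mul_zero, Circle.exp_zero]
end
end

section
/- The linear torus action of T^r on S^{2n−1} determined by the weight matrix z has finite type: the set of subgroups of T^r that occur as the stabilizer {t ∈ T^r : t • x = x} of some point x ∈ S^{2n−1} is finite. -/
open scoped BigOperators

noncomputable section

/-- The linear torus action determined by `z` has finite type: only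
finitely many subsets of `T^r` occur as stabilizers of points of the sphere. -/
theorem torusStab_finite_type (n r : ℕ) (z : Fin r → Fin n → ℤ) :
    {S : Set (Fin r → Circle) | ∃ x : Sph n, torusStab z x = S}.Finite := by
  refine (Set.finite_range (fun s : Set (Fin n) =>
    {t : Fin r → Circle | ∀ j ∈ s, (weightProd z t j : ℂ) = 1})).subset ?_
  rintro S ⟨x, rfl⟩
  refine ⟨{j | (x : EuclideanSpace ℂ (Fin n)) j ≠ 0}, ?_⟩
  ext t
  simp only [torusStab, Set.mem_setOf_eq]
  refine forall_congr' fun j => ?_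
  constructor
  · intro h
    by_cases hx : (x : EuclideanSpace ℂ (Fin n)) j = 0
    · rw [hx, mul_zero]
    · rw [h hx, one_mul]
  · intro h hx
    exact mul_right_cancel₀ hx (h.trans (one_mul _).symm)
end
end

section
/- Let r ≥ 1 and let w : Fin r → ℤ be a nonzero vector with a = gcd of the |w i|. Then the kernel of the continuous group homomorphism χ_w : (Fin r → Circle) → Circle given by χ_w(t) = ∏ i, (t i)^(w i) is isomorphic, as a topological group, to (Fin (r−1) → Circle) × ZMod a, i.e. to the product of an (r−1)-dimensional torus with a cyclic group of order a. -/
open scoped BigOperators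

noncomputable section

/-- The character `χ_w : T^r → Circle`, `t ↦ ∏ i, (t i) ^ (w i)`, as a monoid
homomorphism (it is moreover continuous). -/
def chi {r : ℕ} (w : Fin r → ℤ) : (Fin r → Circle) →* Circle where
  toFun t := ∏ i, t i ^ w i
  map_one' := by simp
  map_mul' t s := by simp [mul_zpow, Finset.prod_mul_distrib]


def phiHom {n m : ℕ} (A : Matrix (Fin n) (Fin m) ℤ) : (Fin m → Circle) →* (Fin n → Circle) where
  toFun t i := ∏ j, t j ^ A i j
  map_one' := by ext; simp
  map_mul' t s := by ext i; simp [mul_zpow, Finset.prod_mul_distrib]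

lemma phiHom_apply {n m : ℕ} (A : Matrix (Fin n) (Fin m) ℤ) (t : Fin m → Circle) (i : Fin n) :
    phiHom A t i = ∏ j, t j ^ A i j := rfl

lemma circle_zpow_sum {ι : Type*} (s : Finset ι) (x : Circle) (g : ι → ℤ) :
    x ^ (∑ i ∈ s, g i) = ∏ i ∈ s, x ^ g i := by
  classical
  induction s using Finset.induction_on with
  | empty => simp
  | insert i s hi ih => rw [Finset.sum_insert hi, Finset.prod_insert hi, zpow_add, ih]

lemma circle_prod_zpow {ι : Type*} (s : Finset ι) (x : ι → Circle) (c : ℤ) :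
    (∏ i ∈ s, x i) ^ c = ∏ i ∈ s, x i ^ c := (Finset.prod_zpow x s c).symm

lemma phiHom_mul {n : ℕ} (A B : Matrix (Fin n) (Fin n) ℤ) (t : Fin n → Circle) :
    phiHom (A * B) t = phiHom A (phiHom B t) := by
  funext i
  simp only [phiHom_apply, Matrix.mul_apply, circle_zpow_sum, circle_prod_zpow]
  rw [Finset.prod_comm]
  refine Finset.prod_congr rfl fun j _ => Finset.prod_congr rfl fun k _ => ?_
  rw [← zpow_mul, mul_comm]

lemma phiHom_one {n : ℕ} (t : Fin n → Circle) : phiHom (1 : Matrix (Fin n) (Fin n) ℤ) t = t := by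
  funext i
  rw [phiHom_apply, Finset.prod_eq_single i]
  · simp
  · intro j _ hj
    simp [Matrix.one_apply_ne hj.symm]
  · simp

lemma phiHom_continuous {n m : ℕ} (A : Matrix (Fin n) (Fin m) ℤ) : Continuous (phiHom A) := by
  refine continuous_pi fun i => ?_
  simp only [phiHom_apply]
  exact continuous_finsetProd _ fun j _ => (continuous_apply j).zpow _

lemma exists_basis_smul {r : ℕ} (w : Fin r → ℤ) (hw : w ≠ 0) :
    ∃ (b : Module.Basis (Fin r) ℤ (Fin r → ℤ)) (i : Fin r) (c : ℤ), w = c • b i := by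
  obtain ⟨n, bM, bN, f, a, snf⟩ :=
    (Submodule.span ℤ {w}).smithNormalForm (Pi.basisFun ℤ (Fin r))
  have h1 : Module.finrank ℤ (Submodule.span ℤ {w}) = 1 := by
    rw [← (LinearEquiv.toSpanNonzeroSingleton ℤ (Fin r → ℤ) w hw).finrank_eq]
    simp
  have hn : n = 1 := by
    rw [Module.finrank_eq_card_basis bN] at h1
    simpa using h1
  subst hn
  have h := bN.sum_repr ⟨w, Submodule.mem_span_singleton_self w⟩
  simp only [Fin.sum_univ_one] at h
  have h' := congrArg Subtype.val h
  refine ⟨bM, f 0, bN.repr ⟨w, Submodule.mem_span_singleton_self w⟩ 0 * a 0, ?_⟩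
  rw [mul_smul, ← snf]
  exact h'.symm

lemma exists_matrix {r : ℕ} (w : Fin r → ℤ) (hw : w ≠ 0) (a : ℕ)
    (ha : a = Finset.univ.gcd fun i => (w i).natAbs) :
    ∃ (P Q : Matrix (Fin r) (Fin r) ℤ) (i : Fin r) (c : ℤ), P * Q = 1 ∧ Q * P = 1 ∧
      (∀ j, w j = c * P i j) ∧ c.natAbs = a := by
  obtain ⟨b, i, c, h⟩ := exists_basis_smul w hw
  have e1 := b.toMatrix_mul_toMatrix_flip (Pi.basisFun ℤ (Fin r))
  have e2 := (Pi.basisFun ℤ (Fin r)).toMatrix_mul_toMatrix_flip b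
  have hP : ∀ i j, ((Pi.basisFun ℤ (Fin r)).toMatrix b) j i = b i j := by
    intro i j; simp [Module.Basis.toMatrix_apply]
  refine ⟨((Pi.basisFun ℤ (Fin r)).toMatrix b).transpose,
    (b.toMatrix (Pi.basisFun ℤ (Fin r))).transpose, i, c, ?_, ?_, ?_, ?_⟩
  · rw [← Matrix.transpose_mul, e1, Matrix.transpose_one]
  · rw [← Matrix.transpose_mul, e2, Matrix.transpose_one]
  · intro j
    rw [Matrix.transpose_apply, hP, h]; simp
  · apply Nat.dvd_antisymm
    · rw [ha]
      refine Finset.dvd_gcd fun j _ => ?_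
      rw [h]; simp [Int.natAbs_mul]
    · have hd : ∀ j, ∃ x, w j = (a : ℤ) * x := fun j => by
        have : a ∣ (w j).natAbs := ha ▸ Finset.gcd_dvd (Finset.mem_univ j)
        exact Int.natCast_dvd.mpr this
      choose x hx using hd
      have hx' : w = (a : ℤ) • x := by funext j; simp [hx]
      have := congrArg (fun v => b.repr v i) (h.symm.trans hx')
      simp only [map_smul, Finsupp.smul_apply, Module.Basis.repr_self, Finsupp.single_eq_same,
        smul_eq_mul, mul_one] at this
      rw [this, Int.natAbs_mul]
      simp

lemma toCircle_surj (a : ℕ) [NeZero a] (s : Circle) (hs : s ^ a = 1) :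
    ∃ z : ZMod a, ZMod.toCircle z = s := by
  have h := Complex.isPrimitiveRoot_exp a (NeZero.ne a)
  have hs' : (s : ℂ) ^ a = 1 := by rw [← Circle.coe_pow, hs, Circle.coe_one]
  obtain ⟨k, _, hk⟩ := h.eq_pow_of_pow_eq_one hs'
  refine ⟨((k : ℤ) : ZMod a), ?_⟩
  apply Circle.ext
  rw [ZMod.toCircle_intCast, ← hk, ← Complex.exp_nat_mul]
  congr 1
  push_cast
  ring

lemma toCircle_pow (a : ℕ) [NeZero a] (z : ZMod a) : ZMod.toCircle z ^ a = 1 := by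
  rw [← AddChar.map_nsmul_eq_pow]
  simp

lemma chi_eq {r : ℕ} (w : Fin r → ℤ) (P : Matrix (Fin r) (Fin r) ℤ) (i : Fin r) (c : ℤ)
    (h : ∀ j, w j = c * P i j) (t : Fin r → Circle) : chi w t = phiHom P t i ^ c := by
  rw [phiHom_apply, circle_prod_zpow]
  change ∏ j, t j ^ w j = _
  refine Finset.prod_congr rfl fun j _ => ?_
  rw [h, ← zpow_mul, mul_comm]

lemma zpow_eq_one_iff_natAbs (s : Circle) (c : ℤ) : s ^ c = 1 ↔ s ^ c.natAbs = 1 := by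
  rw [← orderOf_dvd_iff_zpow_eq_one, ← orderOf_dvd_iff_pow_eq_one, Int.natCast_dvd]

/-- For `r ≥ 1` and a nonzero integer vector `w` with
`a = gcd |w i|`, the kernel of the character `χ_w` is isomorphic as a topological group to
the product of an `(r-1)`-dimensional torus and a cyclic group of order `a`. -/
theorem ker_chi_iso (r : ℕ) (hr : 1 ≤ r) (w : Fin r → ℤ) (hw : w ≠ 0) (a : ℕ)
    (ha : a = Finset.univ.gcd fun i => (w i).natAbs) :
    ∃ e : MonoidHom.ker (chi w) ≃* ((Fin (r - 1) → Circle) × Multiplicative (ZMod a)),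
      Continuous e ∧ Continuous e.symm := by
  obtain ⟨n, rfl⟩ : ∃ n, r = n + 1 := ⟨r - 1, by omega⟩
  obtain ⟨P, Q, i, c, hPQ, hQP, hP, hc⟩ := exists_matrix w hw a ha
  have ha0 : a ≠ 0 := by
    rintro rfl
    apply hw
    funext j
    rw [hP j, Int.natAbs_eq_zero.mp hc]; simp
  haveI : NeZero a := ⟨ha0⟩
  clear ha
  change ∃ e : MonoidHom.ker (chi w) ≃* ((Fin n → Circle) × Multiplicative (ZMod a)),
      Continuous e ∧ Continuous e.symm
  have hker : ∀ t, t ∈ MonoidHom.ker (chi w) ↔ phiHom P t i ^ a = 1 := fun t => by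
    rw [MonoidHom.mem_ker, chi_eq w P i c hP, zpow_eq_one_iff_natAbs, hc]
  have hPQ' : ∀ t, phiHom P (phiHom Q t) = t := fun t => by
    rw [← phiHom_mul, hPQ, phiHom_one]
  have hQP' : ∀ t, phiHom Q (phiHom P t) = t := fun t => by
    rw [← phiHom_mul, hQP, phiHom_one]
  let ins : ((Fin n → Circle) × Multiplicative (ZMod a)) → (Fin (n + 1) → Circle) := fun x =>
    i.insertNth (α := fun _ => Circle) (ZMod.toCircle x.2.toAdd) x.1
  have ins_same : ∀ x, ins x i = ZMod.toCircle x.2.toAdd := fun x => by simp [ins]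
  have ins_succ : ∀ x k, ins x (i.succAbove k) = x.1 k := fun x k => by simp [ins]
  let ψ : ((Fin n → Circle) × Multiplicative (ZMod a)) →* MonoidHom.ker (chi w) :=
    MonoidHom.mk' (fun x => ⟨phiHom Q (ins x), by
      rw [hker, hPQ', ins_same, toCircle_pow]⟩) (by
      intro x y
      apply Subtype.ext
      change phiHom Q (ins (x * y)) = phiHom Q (ins x) * phiHom Q (ins y)
      rw [← map_mul]
      congr 1
      funext k
      refine Fin.succAboveCases i ?_ (fun k => ?_) k
      · simp [ins_same, AddChar.map_add_eq_mul]
      · simp [ins_succ])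
  have hψ : ∀ x, (ψ x : Fin (n + 1) → Circle) = phiHom Q (ins x) := fun x => rfl
  have hcont : Continuous ψ := by
    refine Continuous.subtype_mk ((phiHom_continuous Q).comp ?_) _
    refine continuous_pi fun k => ?_
    refine Fin.succAboveCases i ?_ (fun k => ?_) k
    · simp only [ins_same]
      exact (continuous_of_discreteTopology (f := fun z : Multiplicative (ZMod a) =>
        ZMod.toCircle z.toAdd)).comp continuous_snd
    · simp only [ins_succ]
      fun_prop
  have hbij : Function.Bijective ψ := by
    constructor
    · intro x y hxy
      have h1 : phiHom Q (ins x) = phiHom Q (ins y) := congrArg Subtype.val hxy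
      have h2 : ins x = ins y := by rw [← hPQ' (ins x), h1, hPQ']
      apply Prod.ext
      · funext k
        rw [← ins_succ, h2, ins_succ]
      · have h3 := congrFun h2 i
        rw [ins_same, ins_same] at h3
        exact ZMod.injective_toCircle h3
    · rintro ⟨t, ht⟩
      obtain ⟨z, hz⟩ := toCircle_surj a _ ((hker t).mp ht)
      refine ⟨(fun k => phiHom P t (i.succAbove k), Multiplicative.ofAdd z), ?_⟩
      apply Subtype.ext
      rw [hψ]
      change _ = t
      rw [← hQP' t]
      congr 1
      funext k
      refine Fin.succAboveCases i ?_ (fun k => ?_) k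
      · rw [ins_same, hQP']; exact hz
      · rw [ins_succ, hQP']
  let E := MulEquiv.ofBijective ψ hbij
  refine ⟨E.symm, ?_, hcont⟩
  exact Continuous.continuous_symm_of_equiv_compact_to_t2 (f := E.toEquiv) hcont
end
end
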